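/- arXiv:0909.3333 — 5 statements merged into one kernel-verified Lean document; each statement's English description precedes it below -/
import Mathlib

section
/- Let ν_n^b be the sampling measure of the generalized Pareto (GPD) mixture algorithm with mixing probabilities p_i = (n−i)/(n−i+1), q_i = 1−p_i, and level parameter a = a_b ∈ (0,1) depending on b in such a way that 1−a_b is of exact order b^{−1/(2(n−1))+δ} for some 0 < δ < 1/(2(n−1)). Then the GPD mixture algorithm has asymptotically optimal relative error for computing p_b = P(S_n > b): lim_{b→∞} E p̂_b² / p_b² = 1. -/
open MeasureTheory Filter Set Real

theorem quasiMeasurePreserving_const_mul {u : ℝ} (hu : u ≠ 0) :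
    Measure.QuasiMeasurePreserving (fun y : ℝ => u * y) volume volume := by
  refine ⟨measurable_const_mul u, ?_⟩
  rw [Real.map_volume_mul_left hu]
  exact Measure.smul_absolutelyContinuous

/-- Uniform convergence theorem for slowly varying functions, in additive form. -/
theorem uniform_convergence_of_slowly_varying {l : ℝ → ℝ} (hl : AEMeasurable l volume)
    (hlim : ∀ x : ℝ, 0 < x → Tendsto (fun u => l (u * x) - l u) atTop (nhds 0))
    {K : ℝ} (hK : 1 ≤ K) {ε : ℝ} (hε : 0 < ε) :
    ∀ᶠ u in atTop, ∀ x ∈ Icc 1 K, |l (u * x) - l u| ≤ ε := by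
  set φ : ℝ → ℝ → ℝ := fun u y => min 1 |l (u * y) - l u| with hφ
  have hφ0 : ∀ u y, 0 ≤ φ u y := fun u y => le_min zero_le_one (abs_nonneg _)
  have hφ1 : ∀ u y, φ u y ≤ 1 := fun u y => min_le_left _ _
  have hmeas : ∀ u, u ≠ 0 → AEStronglyMeasurable (φ u) volume := by
    intro u hu
    have h1 : AEMeasurable (fun y => l (u * y)) volume :=
      hl.comp_quasiMeasurePreserving (quasiMeasurePreserving_const_mul hu)
    have h2 : AEMeasurable (fun y => |l (u * y) - l u|) volume :=
      measurable_abs.comp_aemeasurable (h1.sub_const _)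
    exact (aemeasurable_const.min h2).aestronglyMeasurable
  have hii : ∀ u, u ≠ 0 → ∀ p q : ℝ, IntervalIntegrable (φ u) volume p q := by
    intro u hu p q
    refine (intervalIntegrable_const (c := (1 : ℝ))).mono_fun (hmeas u hu).restrict ?_
    refine ae_of_all _ fun y => ?_
    simpa [abs_of_nonneg (hφ0 u y)] using hφ1 u y
  have hI : ∀ M : ℝ, 1 ≤ M → Tendsto (fun u => ∫ y in (1 : ℝ)..M, φ u y) atTop (nhds 0) := by
    intro M hM
    have := intervalIntegral.tendsto_integral_filter_of_dominated_convergence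
      (μ := volume) (a := (1 : ℝ)) (b := M) (l := atTop) (F := φ) (f := fun _ => (0 : ℝ))
      (fun _ => (1 : ℝ)) ?_ ?_ ?_ ?_
    · simpa using this
    · filter_upwards [eventually_ne_atTop 0] with u hu using (hmeas u hu).restrict
    · refine Eventually.of_forall fun u => ae_of_all _ fun y _ => ?_
      rw [Real.norm_of_nonneg (hφ0 u y)]
      exact hφ1 u y
    · exact intervalIntegrable_const
    · refine ae_of_all _ fun y hy => ?_
      rw [uIoc_of_le hM] at hy
      have h := (hlim y (by linarith [hy.1])).abs
      have h2 := (tendsto_const_nhds (x := (1 : ℝ))).min h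
      simpa [hφ] using h2
  set ε' := min ε (1 / 2) with hε'
  have hε'0 : 0 < ε' := lt_min hε (by norm_num)
  have h1 := (hI (2 * K) (by linarith)).eventually (gt_mem_nhds (half_pos hε'0))
  have h2 := eventually_forall_ge_atTop.2
    ((hI 2 (by norm_num)).eventually (gt_mem_nhds (half_pos hε'0)))
  filter_upwards [h1, h2, eventually_gt_atTop 0] with u hu1 hu2 hu0 x hx
  have hx0 : 0 < x := by linarith [hx.1]
  have hux : u ≤ u * x := le_mul_of_one_le_right hu0.le hx.1
  have hux0 : 0 < u * x := by positivity
  have key : ∀ s, φ u x ≤ φ u (x * s) + φ (u * x) s := by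
    intro s
    have h3 : |l (u * x) - l u| ≤ |l (u * (x * s)) - l u| + |l (u * x * s) - l (u * x)| := by
      rw [← mul_assoc]
      have := abs_sub_le (l (u * x)) (l (u * x * s)) (l u)
      rw [abs_sub_comm (l (u * x)) (l (u * x * s))] at this
      linarith
    simp only [hφ]
    rcases le_total 1 |l (u * (x * s)) - l u| with h | h
    · rw [min_eq_left h]
      have := hφ0 (u * x) s
      simp only [hφ] at this
      have := min_le_left 1 |l (u * x) - l u|
      linarith
    · rcases le_total 1 |l (u * x * s) - l (u * x)| with h' | h'
      · rw [min_eq_left h', min_eq_right h]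
        have := min_le_left 1 |l (u * x) - l u|
        have := abs_nonneg (l (u * (x * s)) - l u)
        linarith
      · rw [min_eq_right h', min_eq_right h]
        exact (min_le_right _ _).trans h3
  have hcomp : ∫ s in (1 : ℝ)..2, φ u (x * s) = x⁻¹ * ∫ y in x..(x * 2), φ u y := by
    have := intervalIntegral.integral_comp_mul_left (a := 1) (b := 2) (φ u) hx0.ne'
    simpa using this
  have hle : ∫ y in x..(x * 2), φ u y ≤ ∫ y in (1 : ℝ)..(2 * K), φ u y := by
    refine intervalIntegral.integral_mono_interval hx.1 (by linarith) (by linarith [hx.2]) ?_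
      (hii u hu0.ne' _ _)
    exact ae_of_all _ fun y => hφ0 u y
  have hint : IntervalIntegrable (fun s => φ u (x * s)) volume 1 2 := by
    have := (hii u hu0.ne' (x * 1) (x * 2)).comp_mul_left (c := x)
    have e1 : x * 1 / x = 1 := by field_simp
    have e2 : x * 2 / x = 2 := by field_simp
    rw [e1, e2] at this
    exact this
  have hfin : φ u x ≤ (∫ s in (1 : ℝ)..2, φ u (x * s)) + ∫ s in (1 : ℝ)..2, φ (u * x) s := by
    rw [← intervalIntegral.integral_add hint (hii _ hux0.ne' _ _)]
    have : φ u x = ∫ _ in (1 : ℝ)..2, φ u x := by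
      simp only [intervalIntegral.integral_const, smul_eq_mul]; ring
    rw [this]
    exact intervalIntegral.integral_mono_on (by norm_num) intervalIntegrable_const
      (hint.add (hii _ hux0.ne' _ _)) fun s _ => key s
  have hx1 : x⁻¹ * ∫ y in x..(x * 2), φ u y ≤ ∫ y in x..(x * 2), φ u y := by
    refine mul_le_of_le_one_left ?_ (inv_le_one_of_one_le₀ hx.1)
    exact intervalIntegral.integral_nonneg (by linarith) fun y _ => hφ0 u y
  have h4 := hu2 (u * x) hux
  have h5 : φ u x < ε' := by linarith [hcomp]
  simp only [hφ] at h5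
  rcases min_lt_iff.1 h5 with h | h
  · have := min_le_right ε (1 / 2 : ℝ); linarith
  · exact h.le.trans (min_le_left _ _)

/-- Potter-type upper bound for slowly varying functions, in additive form. -/
theorem potter_bound_of_slowly_varying {l : ℝ → ℝ} (hl : AEMeasurable l volume)
    (hlim : ∀ x : ℝ, 0 < x → Tendsto (fun u => l (u * x) - l u) atTop (nhds 0))
    {ε : ℝ} (hε : 0 < ε) :
    ∀ᶠ u in atTop, ∀ y, 1 ≤ y → l (u * y) - l u ≤ ε * Real.log 2 + ε * Real.log y := by
  have hlog2 : 0 < Real.log 2 := Real.log_pos (by norm_num)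
  have h := uniform_convergence_of_slowly_varying hl hlim (K := 2) (by norm_num)
    (mul_pos hε hlog2)
  filter_upwards [eventually_forall_ge_atTop.2 h, eventually_gt_atTop 0] with U hU hU0
  have claim : ∀ k : ℕ, ∀ u, U ≤ u → ∀ y, 1 ≤ y → y ≤ 2 ^ k →
      l (u * y) - l u ≤ ε * Real.log 2 + ε * Real.log y := by
    intro k
    induction k with
    | zero =>
      intro u hu y hy hy1
      have := (abs_le.1 (hU u hu y ⟨hy, by simp at hy1; linarith⟩)).2
      have := mul_nonneg hε.le (Real.log_nonneg hy)
      linarith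
    | succ k ih =>
      intro u hu y hy hy1
      rcases le_total y 2 with h2 | h2
      · have := (abs_le.1 (hU u hu y ⟨hy, h2⟩)).2
        have := mul_nonneg hε.le (Real.log_nonneg hy)
        linarith
      · have e1 := (abs_le.1 (hU u hu 2 ⟨by norm_num, le_rfl⟩)).2
        have e2 := ih (u * 2) (by linarith) (y / 2) (by linarith)
          (by rw [pow_succ] at hy1; linarith)
        rw [show u * 2 * (y / 2) = u * y by ring, Real.log_div (by linarith) (by norm_num)] at e2
        linarith
  intro y hy
  obtain ⟨k, hk⟩ := pow_unbounded_of_one_lt y (by norm_num : (1 : ℝ) < 2)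
  exact claim k U le_rfl y hy hk.le

section RegularVariation

variable {α : ℝ} {f : ℝ → ℝ}

theorem eventually_pos_of_regularly_varying (hf_nonneg : ∀ x, 0 ≤ f x)
    (hf_rv : ∀ x : ℝ, 0 < x →
      Tendsto (fun u => f (u * x) / f u) atTop (nhds (x ^ (-α - 1)))) :
    ∀ᶠ u in atTop, 0 < f u := by
  have h := hf_rv 1 one_pos
  rw [Real.one_rpow] at h
  filter_upwards [h.eventually (lt_mem_nhds one_pos)] with u hu
  refine lt_of_le_of_ne (hf_nonneg u) fun h0 => ?_
  rw [← h0, div_zero] at hu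
  exact lt_irrefl _ hu

theorem slowly_varying_part_tendsto (hf_nonneg : ∀ x, 0 ≤ f x)
    (hf_rv : ∀ x : ℝ, 0 < x →
      Tendsto (fun u => f (u * x) / f u) atTop (nhds (x ^ (-α - 1)))) :
    ∀ x : ℝ, 0 < x → Tendsto (fun u => (Real.log (f (u * x)) + (α + 1) * Real.log (u * x)) -
      (Real.log (f u) + (α + 1) * Real.log u)) atTop (nhds 0) := by
  intro x hx
  have h := (hf_rv x hx).log (Real.rpow_pos_of_pos hx _).ne'
  have h2 := h.add_const ((α + 1) * Real.log x)
  rw [Real.log_rpow hx] at h2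
  have e : (-α - 1) * Real.log x + (α + 1) * Real.log x = 0 := by ring
  rw [e] at h2
  refine h2.congr' ?_
  have hp := eventually_pos_of_regularly_varying hf_nonneg hf_rv
  filter_upwards [hp, (tendsto_id.atTop_mul_const hx).eventually hp, eventually_gt_atTop 0]
    with u h3 h4 h5
  simp only [id] at h4
  rw [Real.log_div h4.ne' h3.ne', Real.log_mul h5.ne' hx.ne']
  ring

theorem aemeasurable_slowly_varying_part (hf_meas : AEMeasurable f volume) :
    AEMeasurable (fun u => Real.log (f u) + (α + 1) * Real.log u) volume :=
  (Real.measurable_log.comp_aemeasurable hf_meas).add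
    (Real.measurable_log.const_mul _).aemeasurable

theorem potter_bound (hf_nonneg : ∀ x, 0 ≤ f x) (hf_meas : AEMeasurable f volume)
    (hf_rv : ∀ x : ℝ, 0 < x →
      Tendsto (fun u => f (u * x) / f u) atTop (nhds (x ^ (-α - 1)))) {ε : ℝ} (hε : 0 < ε) :
    ∀ᶠ u in atTop, ∀ y, 1 ≤ y →
      f (u * y) / f u ≤ Real.exp (ε * Real.log 2) * y ^ (-α - 1 + ε) := by
  have hp := eventually_pos_of_regularly_varying hf_nonneg hf_rv
  filter_upwards [potter_bound_of_slowly_varying (aemeasurable_slowly_varying_part hf_meas)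
    (slowly_varying_part_tendsto hf_nonneg hf_rv) hε, eventually_forall_ge_atTop.2 hp,
    eventually_gt_atTop 0] with u h1 h2 h3 y hy
  have hy0 : 0 < y := by linarith
  have hfu := h2 u le_rfl
  have hfuy := h2 (u * y) (le_mul_of_one_le_right h3.le hy)
  have h := h1 y hy
  rw [Real.log_mul h3.ne' hy0.ne'] at h
  rw [Real.rpow_def_of_pos hy0, ← Real.exp_add, ← Real.log_le_iff_le_exp (by positivity),
    Real.log_div hfuy.ne' hfu.ne']
  linarith

theorem tendsto_integral_ratio (hα : 0 < α) (hf_nonneg : ∀ x, 0 ≤ f x)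
    (hf_meas : AEMeasurable f volume)
    (hf_rv : ∀ x : ℝ, 0 < x →
      Tendsto (fun u => f (u * x) / f u) atTop (nhds (x ^ (-α - 1))))
    (k : ℕ) (β : ℝ) (hkβ : (-α - 1) * k + β = -α - 1) :
    (∀ᶠ u in atTop, IntegrableOn (fun y => (f (u * y) / f u) ^ k * y ^ β) (Ioi 1)) ∧
    Tendsto (fun u => ∫ y in Ioi (1 : ℝ), (f (u * y) / f u) ^ k * y ^ β) atTop
      (nhds (1 / α)) := by
  set ε := α / (2 * (k + 1)) with hε
  have hk1 : (0 : ℝ) < k + 1 := by positivity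
  have hε0 : 0 < ε := by positivity
  have hkε : ε * k < α := by
    rw [hε, div_mul_eq_mul_div, div_lt_iff₀ (by positivity)]
    nlinarith
  set C := Real.exp (ε * Real.log 2) ^ k with hC
  have hbound : ∀ᶠ u in atTop, ∀ y, 1 ≤ y →
      (f (u * y) / f u) ^ k * y ^ β ≤ C * y ^ (-α - 1 + ε * k) := by
    filter_upwards [potter_bound hf_nonneg hf_meas hf_rv hε0] with u hu y hy
    have hy0 : 0 < y := by linarith
    have h0 : 0 ≤ f (u * y) / f u := div_nonneg (hf_nonneg _) (hf_nonneg _)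
    have h1 := pow_le_pow_left₀ h0 (hu y hy) k
    rw [mul_pow, ← Real.rpow_mul_natCast hy0.le] at h1
    calc (f (u * y) / f u) ^ k * y ^ β ≤ C * y ^ ((-α - 1 + ε) * k) * y ^ β := by
          gcongr
      _ = C * y ^ (-α - 1 + ε * k) := by
          rw [mul_assoc, ← Real.rpow_add hy0]
          congr 2
          linarith
  have hdom : IntegrableOn (fun y : ℝ => C * y ^ (-α - 1 + ε * k)) (Ioi 1) :=
    (integrableOn_Ioi_rpow_of_lt (by linarith) one_pos).const_mul C
  have hmeas : ∀ᶠ u in atTop,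
      AEStronglyMeasurable (fun y => (f (u * y) / f u) ^ k * y ^ β) (volume.restrict (Ioi 1)) := by
    filter_upwards [eventually_ne_atTop 0] with u hu
    have h1 : AEMeasurable (fun y => f (u * y)) volume :=
      hf_meas.comp_quasiMeasurePreserving (quasiMeasurePreserving_const_mul hu)
    exact (((h1.div_const _).pow_const k).mul
      (measurable_id.pow_const β).aemeasurable).aestronglyMeasurable.restrict
  have hnorm : ∀ᶠ u in atTop, ∀ᵐ y ∂(volume.restrict (Ioi (1 : ℝ))),
      ‖(f (u * y) / f u) ^ k * y ^ β‖ ≤ C * y ^ (-α - 1 + ε * k) := by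
    filter_upwards [hbound] with u hu
    filter_upwards [ae_restrict_mem measurableSet_Ioi] with y hy
    have hy0 : 0 < y := one_pos.trans hy
    have h0 : 0 ≤ f (u * y) / f u := div_nonneg (hf_nonneg _) (hf_nonneg _)
    rw [Real.norm_of_nonneg (by positivity)]
    exact hu y (le_of_lt hy)
  refine ⟨?_, ?_⟩
  · filter_upwards [hmeas, hnorm] with u h1 h2 using hdom.mono' h1 h2
  · have hval : ∫ y in Ioi (1 : ℝ), y ^ (-α - 1) = 1 / α := by
      rw [integral_Ioi_rpow_of_lt (by linarith) one_pos, Real.one_rpow]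
      have : -α - 1 + 1 = -α := by ring
      rw [this, neg_div_neg_eq]
    rw [← hval]
    refine tendsto_integral_filter_of_dominated_convergence _ hmeas hnorm hdom ?_
    filter_upwards [ae_restrict_mem measurableSet_Ioi] with y hy
    have hy0 : (0 : ℝ) < y := one_pos.trans hy
    have := ((hf_rv y hy0).pow k).mul_const (y ^ β)
    rwa [← Real.rpow_mul_natCast hy0.le, ← Real.rpow_add hy0, hkβ] at this

theorem setIntegral_Ioi_eq_scaled {k : ℕ} {β u : ℝ} (hu : 0 < u) (hfu : 0 < f u) :
    ∫ x in Ioi u, f x ^ k * x ^ β =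
      u * f u ^ k * u ^ β * ∫ y in Ioi (1 : ℝ), (f (u * y) / f u) ^ k * y ^ β := by
  have h := integral_comp_mul_left_Ioi (fun x => f x ^ k * x ^ β) 1 hu
  rw [mul_one] at h
  have h2 : ∫ y in Ioi (1 : ℝ), f (u * y) ^ k * (u * y) ^ β =
      (f u ^ k * u ^ β) * ∫ y in Ioi (1 : ℝ), (f (u * y) / f u) ^ k * y ^ β := by
    rw [← integral_const_mul]
    refine setIntegral_congr_fun measurableSet_Ioi fun y hy => ?_
    have hy0 : (0 : ℝ) < y := one_pos.trans hy
    rw [Real.mul_rpow hu.le hy0.le, div_pow]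
    field_simp
  rw [h2, smul_eq_mul] at h
  field_simp at h
  linarith

theorem integrableOn_Ioi_of_scaled {k : ℕ} {β u : ℝ} (hu : 0 < u) (hfu : 0 < f u)
    (h : IntegrableOn (fun y => (f (u * y) / f u) ^ k * y ^ β) (Ioi 1)) :
    IntegrableOn (fun x => f x ^ k * x ^ β) (Ioi u) := by
  have h1 := integrableOn_Ioi_comp_mul_left_iff (fun x => f x ^ k * x ^ β) 1 hu
  rw [mul_one] at h1
  rw [← h1]
  have h2 : IntegrableOn (fun y => f u ^ k * u ^ β * ((f (u * y) / f u) ^ k * y ^ β)) (Ioi 1) :=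
    h.const_mul (f u ^ k * u ^ β)
  refine h2.congr_fun (fun y hy => ?_) measurableSet_Ioi
  have hy0 : (0 : ℝ) < y := one_pos.trans hy
  simp only
  rw [Real.mul_rpow hu.le hy0.le, div_pow]
  field_simp

/-- Karamata's theorem for the tail of a regularly varying density. -/
theorem tendsto_tail_div (hα : 0 < α) (hf_nonneg : ∀ x, 0 ≤ f x)
    (hf_meas : AEMeasurable f volume)
    (hf_rv : ∀ x : ℝ, 0 < x →
      Tendsto (fun u => f (u * x) / f u) atTop (nhds (x ^ (-α - 1)))) :
    Tendsto (fun u => (∫ x in Ioi u, f x) / (u * f u)) atTop (nhds (1 / α)) := by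
  refine (tendsto_integral_ratio hα hf_nonneg hf_meas hf_rv 1 0 (by simp)).2.congr' ?_
  filter_upwards [eventually_pos_of_regularly_varying hf_nonneg hf_rv,
    eventually_gt_atTop 0] with u h1 h2
  have := setIntegral_Ioi_eq_scaled (f := f) (k := 1) (β := 0) h2 h1
  simp only [pow_one, Real.rpow_zero, mul_one] at this ⊢
  rw [this]
  field_simp

theorem tail_regularly_varying (hα : 0 < α) (hf_nonneg : ∀ x, 0 ≤ f x)
    (hf_meas : AEMeasurable f volume)
    (hf_rv : ∀ x : ℝ, 0 < x →
      Tendsto (fun u => f (u * x) / f u) atTop (nhds (x ^ (-α - 1)))) {θ : ℝ} (hθ : 0 < θ) :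
    Tendsto (fun u => (∫ x in Ioi (θ * u), f x) / ∫ x in Ioi u, f x) atTop
      (nhds (θ ^ (-α))) := by
  have h := tendsto_tail_div hα hf_nonneg hf_meas hf_rv
  have h1 := h.comp (tendsto_id.const_mul_atTop hθ)
  have h2 := ((h1.div h (by positivity)).mul (hf_rv θ hθ)).const_mul θ
  have e : θ * (1 / α / (1 / α) * θ ^ (-α - 1)) = θ ^ (-α) := by
    rw [div_self (by positivity), one_mul, Real.rpow_sub_one hθ.ne']
    field_simp
  rw [e] at h2
  refine h2.congr' ?_
  have hp := eventually_pos_of_regularly_varying hf_nonneg hf_rv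
  filter_upwards [hp, (tendsto_id.const_mul_atTop hθ).eventually hp, eventually_gt_atTop 0]
    with u h3 h4 h5
  simp only [Function.comp, id, Pi.div_apply] at h4 ⊢
  rw [mul_comm u θ]
  field_simp

theorem integrableOn_sq_mul_rpow (hα : 0 < α) (hf_nonneg : ∀ x, 0 ≤ f x)
    (hf_meas : AEMeasurable f volume)
    (hf_rv : ∀ x : ℝ, 0 < x →
      Tendsto (fun u => f (u * x) / f u) atTop (nhds (x ^ (-α - 1)))) :
    ∀ᶠ u in atTop, IntegrableOn (fun x => f x ^ 2 * x ^ (α + 1)) (Ioi u) := by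
  filter_upwards [(tendsto_integral_ratio hα hf_nonneg hf_meas hf_rv 2 (α + 1)
    (by push_cast; ring)).1, eventually_pos_of_regularly_varying hf_nonneg hf_rv,
    eventually_gt_atTop 0] with u h1 h2 h3
  exact integrableOn_Ioi_of_scaled h3 h2 h1

theorem tendsto_second_moment_div (hα : 0 < α) (hf_nonneg : ∀ x, 0 ≤ f x)
    (hf_meas : AEMeasurable f volume)
    (hf_rv : ∀ x : ℝ, 0 < x →
      Tendsto (fun u => f (u * x) / f u) atTop (nhds (x ^ (-α - 1)))) :
    Tendsto (fun u => (∫ x in Ioi u, f x ^ 2 * x ^ (α + 1)) / α * u ^ (-α) /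
      (∫ x in Ioi u, f x) ^ 2) atTop (nhds 1) := by
  have h1 := (tendsto_integral_ratio hα hf_nonneg hf_meas hf_rv 2 (α + 1)
    (by push_cast; ring)).2
  have h2 := (tendsto_tail_div hα hf_nonneg hf_meas hf_rv).pow 2
  have h3 := (h1.div_const α).div h2 (by positivity)
  have e : 1 / α / α / (1 / α) ^ 2 = 1 := by field_simp
  rw [e] at h3
  refine h3.congr' ?_
  filter_upwards [eventually_pos_of_regularly_varying hf_nonneg hf_rv,
    eventually_gt_atTop 0] with u h1 h2
  simp only [Pi.div_apply]
  rw [setIntegral_Ioi_eq_scaled (f := f) (k := 2) (β := α + 1) h2 h1, Real.rpow_neg h2.le,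
    Real.rpow_add_one h2.ne']
  field_simp

theorem density_le_tail_div (hα : 0 < α) (hf_nonneg : ∀ x, 0 ≤ f x)
    (hf_meas : AEMeasurable f volume)
    (hf_rv : ∀ x : ℝ, 0 < x →
      Tendsto (fun u => f (u * x) / f u) atTop (nhds (x ^ (-α - 1))))
    {η : ℝ} (hη : 0 < η) (hη1 : η < 1) :
    ∃ C : ℝ, 0 < C ∧ ∀ᶠ u in atTop, ∀ x ∈ Icc (η * u) u,
      f x ≤ C * (∫ t in Ioi u, f t) / u := by
  have hp := eventually_pos_of_regularly_varying hf_nonneg hf_rv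
  have hu := uniform_convergence_of_slowly_varying (aemeasurable_slowly_varying_part hf_meas)
    (slowly_varying_part_tendsto (α := α) hf_nonneg hf_rv) (K := η⁻¹)
    (by rw [one_le_inv₀ hη]; exact hη1.le) one_pos
  have hk := (tendsto_tail_div hα hf_nonneg hf_meas hf_rv).eventually
    (lt_mem_nhds (show 1 / (2 * α) < 1 / α by
      apply one_div_lt_one_div_of_lt hα; linarith))
  have hC : 0 < Real.exp (1 + (α + 1) * Real.log η⁻¹) := Real.exp_pos _
  refine ⟨2 * α * Real.exp (1 + (α + 1) * Real.log η⁻¹), by positivity, ?_⟩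
  filter_upwards [(tendsto_id.const_mul_atTop hη).eventually
    (eventually_forall_ge_atTop.2 (hp.and hu)), hp, hk, eventually_gt_atTop 0]
    with u h1 h2 h3 h4 x hx
  simp only [id] at h1
  have hηu : 0 < η * u := by positivity
  have hx0 : 0 < x := hηu.trans_le hx.1
  obtain ⟨hfx, hx1⟩ := h1 x hx.1
  have hux : u / x ≤ η⁻¹ := by
    rw [div_le_iff₀ hx0, ← div_eq_inv_mul, le_div_iff₀ hη, mul_comm]; exact hx.1
  have hux1 : 1 ≤ u / x := by rw [one_le_div hx0]; exact hx.2
  have h5 := (abs_le.1 (hx1 (u / x) ⟨hux1, hux⟩)).1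
  rw [mul_div_cancel₀ _ hx0.ne'] at h5
  have h6 : Real.log u - Real.log x ≤ Real.log η⁻¹ := by
    rw [← Real.log_div h4.ne' hx0.ne']
    exact Real.log_le_log (by positivity) hux
  have h7 : Real.log (f x) ≤ (1 + (α + 1) * Real.log η⁻¹) + Real.log (f u) := by
    nlinarith
  have h8 : f x ≤ Real.exp (1 + (α + 1) * Real.log η⁻¹) * f u := by
    rw [Real.log_le_iff_le_exp hfx, Real.exp_add, Real.exp_log h2] at h7
    exact h7
  have h9 : f u ≤ 2 * α * (∫ t in Ioi u, f t) / u := by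
    rw [lt_div_iff₀ (by positivity)] at h3
    rw [le_div_iff₀ h4]
    have := mul_le_mul_of_nonneg_left h3.le (show 0 ≤ 2 * α by positivity)
    have e : 2 * α * (1 / (2 * α) * (u * f u)) = f u * u := by field_simp
    linarith
  calc f x ≤ Real.exp (1 + (α + 1) * Real.log η⁻¹) * f u := h8
    _ ≤ Real.exp (1 + (α + 1) * Real.log η⁻¹) * (2 * α * (∫ t in Ioi u, f t) / u) := by gcongr
    _ = _ := by ring

end RegularVariation

section IteratedIntegral

/-- Iterated integral of a product of kernels evaluated along partial sums; the kernel `φ m`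
is used when `m` further variables remain. -/
noncomputable def iterInt (φ : ℕ → ℝ → ℝ → ENNReal) (T : ℝ → ENNReal) : ℕ → ℝ → ENNReal
  | 0, s => T s
  | m + 1, s => ∫⁻ x, φ m s x * iterInt φ T m (s + x)

/-- Sum of the first `k` coordinates. -/
def partialSum {n : ℕ} (y : Fin n → ℝ) (k : ℕ) : ℝ :=
  ∑ j ∈ Finset.univ.filter (fun j : Fin n => (j : ℕ) < k), y j

theorem partialSum_zero {n : ℕ} (y : Fin n → ℝ) : partialSum y 0 = 0 := by
  simp [partialSum]

theorem partialSum_cons_succ {n : ℕ} (x : ℝ) (y : Fin n → ℝ) (k : ℕ) :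
    partialSum (Fin.cons x y : Fin (n + 1) → ℝ) (k + 1) = x + partialSum y k := by
  simp [partialSum, Finset.sum_filter, Fin.sum_univ_succ]

theorem measurable_partialSum {n : ℕ} (k : ℕ) :
    Measurable (fun y : Fin n → ℝ => partialSum y k) :=
  Finset.measurable_sum _ fun j _ => measurable_pi_apply j

variable {φ : ℕ → ℝ → ℝ → ENNReal} {T : ℝ → ENNReal}

theorem measurable_iterInt (hφ : ∀ m, Measurable (Function.uncurry (φ m))) (hT : Measurable T)
    (m : ℕ) : Measurable (iterInt φ T m) := by
  induction m with
  | zero => exact hT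
  | succ m ih =>
    exact ((hφ m).mul (ih.comp (measurable_fst.add measurable_snd))).lintegral_prod_right'

theorem lintegral_pi_eq_iterInt (hφ : ∀ m, Measurable (Function.uncurry (φ m)))
    (hT : Measurable T) (m : ℕ) (s : ℝ) :
    ∫⁻ x : Fin m → ℝ, T (s + partialSum x m) *
      ∏ i : Fin m, φ (m - 1 - i) (s + partialSum x i) (x i) = iterInt φ T m s := by
  have hmeas : ∀ (m : ℕ) (s : ℝ), Measurable fun x : Fin m → ℝ => T (s + partialSum x m) *
      ∏ i : Fin m, φ (m - 1 - i) (s + partialSum x i) (x i) := by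
    intro m s
    refine (hT.comp ((measurable_partialSum m).const_add s)).mul
      (Finset.measurable_prod _ fun i _ => ?_)
    exact (hφ _).comp (((measurable_partialSum i).const_add s).prodMk (measurable_pi_apply i))
  induction m generalizing s with
  | zero =>
    have : (volume : Measure (Fin 0 → ℝ)) univ = 1 := by simp [volume_pi, Measure.pi_empty_univ]
    simp [iterInt, partialSum, this]
  | succ m ih =>
    have hmp := (volume_preserving_piFinSuccAbove (fun _ : Fin (m + 1) => ℝ) 0).symm
    have hcomp := ((hmeas (m + 1) s).comp
        (MeasurableEquiv.piFinSuccAbove (fun _ : Fin (m + 1) => ℝ) 0).symm.measurable)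
    simp only [Function.comp_def] at hcomp
    rw [← hmp.lintegral_comp (hmeas (m + 1) s), Measure.volume_eq_prod,
      lintegral_prod _ hcomp.aemeasurable]
    simp only [iterInt]
    refine lintegral_congr fun x => ?_
    rw [← ih (s + x), ← lintegral_const_mul _ (hmeas m (s + x))]
    refine lintegral_congr fun y => ?_
    have e : (MeasurableEquiv.piFinSuccAbove (fun _ : Fin (m + 1) => ℝ) 0).symm (x, y) =
        (Fin.cons x y : Fin (m + 1) → ℝ) := by
      simp [MeasurableEquiv.piFinSuccAbove, Fin.insertNthEquiv]
    rw [e, Fin.prod_univ_succ]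
    simp only [partialSum_cons_succ, Fin.cons_zero, Fin.cons_succ, Fin.val_succ, Fin.val_zero,
      partialSum_zero, add_zero, Nat.sub_zero, Nat.add_sub_cancel]
    rw [mul_left_comm, ← add_assoc s x]
    congr 2
    refine Finset.prod_congr rfl fun i _ => ?_
    rw [← add_assoc s x, show m - ((i : ℕ) + 1) = m - 1 - i by omega]

end IteratedIntegral

section Mixture

open scoped ENNReal

/-- Pareto density with index `α` and left endpoint `w`. -/
noncomputable def paretoDensity (α w x : ℝ) : ℝ :=
  if w < x then α * w ^ α * x ^ (-α - 1) else 0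

/-- Conditional sampling densities of the GPD mixture algorithm, indexed by the number of
variables that remain to be sampled afterwards. -/
noncomputable def gpdKernel (α A κ b : ℝ) (f : ℝ → ℝ) : ℕ → ℝ → ℝ → ℝ
  | 0, s, x => if b < s then f x else if s ≤ b - κ then paretoDensity α (b - s) x else f x
  | m + 1, s, x => if b < s then f x else
      ((m + 1 : ℝ) * f x + paretoDensity α (A * (b - s)) x) / (m + 2)

/-- Conditional second moments of the GPD mixture estimator. -/
noncomputable def gpdSecondMoment (α A κ b : ℝ) (f : ℝ → ℝ) : ℕ → ℝ → ℝ≥0∞ :=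
  iterInt (fun m s x => ENNReal.ofReal (f x ^ 2 / gpdKernel α A κ b f m s x))
    ((Ioi b).indicator 1)

/-- Conditional probabilities of exceeding the level `b`. -/
noncomputable def tailProb (b : ℝ) (f : ℝ → ℝ) : ℕ → ℝ → ℝ≥0∞ :=
  iterInt (fun _ _ x => ENNReal.ofReal (f x)) ((Ioi b).indicator 1)

variable {α A κ b : ℝ} {f : ℝ → ℝ}

theorem paretoDensity_nonneg (hα : 0 < α) {w : ℝ} (hw : 0 ≤ w) (x : ℝ) :
    0 ≤ paretoDensity α w x := by
  unfold paretoDensity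
  split_ifs with h
  · have : 0 ≤ x := hw.trans h.le
    positivity
  · exact le_rfl

theorem lintegral_paretoDensity_le (hα : 0 < α) {w : ℝ} (hw : 0 ≤ w) :
    ∫⁻ x, ENNReal.ofReal (paretoDensity α w x) ≤ 1 := by
  rcases hw.eq_or_lt with rfl | hw
  · have : ∀ x, paretoDensity α 0 x = 0 := by
      intro x
      simp [paretoDensity, Real.zero_rpow hα.ne']
    simp [this]
  · have h1 : ∀ x, ENNReal.ofReal (paretoDensity α w x) =
        (Ioi w).indicator (fun x => ENNReal.ofReal (α * w ^ α * x ^ (-α - 1))) x := by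
      intro x
      simp only [paretoDensity, indicator, mem_Ioi]
      split_ifs <;> simp
    simp_rw [h1]
    rw [lintegral_indicator measurableSet_Ioi, ← ofReal_integral_eq_lintegral_ofReal]
    · rw [integral_const_mul, integral_Ioi_rpow_of_lt (by linarith) hw]
      have e : -α - 1 + 1 = -α := by ring
      rw [e, Real.rpow_neg hw.le, ENNReal.ofReal_le_one]
      have := Real.rpow_pos_of_pos hw α
      apply le_of_eq
      field_simp
    · exact (integrableOn_Ioi_rpow_of_lt (by linarith) hw).const_mul _
    · filter_upwards [ae_restrict_mem measurableSet_Ioi] with x hx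
      have : 0 < x := hw.trans hx
      positivity

theorem gpdKernel_of_lt {m : ℕ} {s : ℝ} (h : b < s) (x : ℝ) :
    gpdKernel α A κ b f m s x = f x := by
  cases m <;> simp [gpdKernel, h]

theorem measurable_gpdKernel (hf : Measurable f) (m : ℕ) :
    Measurable (Function.uncurry (gpdKernel α A κ b f m)) := by
  have hP : ∀ g : ℝ → ℝ, Measurable g →
      Measurable fun z : ℝ × ℝ => paretoDensity α (g z.1) z.2 := by
    intro g hg
    unfold paretoDensity
    exact Measurable.ite (measurableSet_lt (hg.comp measurable_fst) measurable_snd)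
      ((((hg.comp measurable_fst).pow_const α).const_mul α).mul (measurable_snd.pow_const _))
      measurable_const
  have hfs : Measurable fun z : ℝ × ℝ => f z.2 := hf.comp measurable_snd
  have hlt : MeasurableSet {z : ℝ × ℝ | b < z.1} := measurableSet_lt measurable_const measurable_fst
  have hbs : Measurable fun s : ℝ => b - s := measurable_id.const_sub b
  cases m with
  | zero =>
    exact Measurable.ite hlt hfs (Measurable.ite
      (measurableSet_le measurable_fst measurable_const) (hP _ hbs) hfs)
  | succ m =>
    exact Measurable.ite hlt hfs (((hfs.const_mul _).add (hP _ (hbs.const_mul A))).div_const _)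

theorem gpdKernel_nonneg (hα : 0 < α) (hA : 0 ≤ A) (hf0 : ∀ x, 0 ≤ f x)
    (m : ℕ) (s x : ℝ) : 0 ≤ gpdKernel α A κ b f m s x := by
  cases m with
  | zero =>
    simp only [gpdKernel]
    split_ifs with h1 h2
    · exact hf0 x
    · exact paretoDensity_nonneg hα (by linarith) x
    · exact hf0 x
  | succ m =>
    simp only [gpdKernel]
    split_ifs with h1
    · exact hf0 x
    · have := paretoDensity_nonneg hα (mul_nonneg hA (by linarith : 0 ≤ b - s)) x
      have := hf0 x
      positivity

theorem lintegral_gpdKernel_le (hα : 0 < α) (hA : 0 ≤ A) (hf : Measurable f)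
    (hf0 : ∀ x, 0 ≤ f x) (hf1 : ∫⁻ x, ENNReal.ofReal (f x) = 1) (m : ℕ) (s : ℝ) :
    ∫⁻ x, ENNReal.ofReal (gpdKernel α A κ b f m s x) ≤ 1 := by
  cases m with
  | zero =>
    simp only [gpdKernel]
    split_ifs with h1 h2
    · exact hf1.le
    · exact lintegral_paretoDensity_le hα (by linarith)
    · exact hf1.le
  | succ m =>
    simp only [gpdKernel]
    split_ifs with h1
    · exact hf1.le
    · have hw : 0 ≤ A * (b - s) := mul_nonneg hA (by linarith)
      have h2 : ∀ x, ENNReal.ofReal (((m + 1 : ℝ) * f x + paretoDensity α (A * (b - s)) x) / (m + 2))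
          = ENNReal.ofReal ((m + 1 : ℝ) / (m + 2)) * ENNReal.ofReal (f x) +
            ENNReal.ofReal (1 / (m + 2 : ℝ)) *
              ENNReal.ofReal (paretoDensity α (A * (b - s)) x) := by
        intro x
        have h3 := paretoDensity_nonneg hα hw x
        have h4 := hf0 x
        rw [← ENNReal.ofReal_mul (by positivity), ← ENNReal.ofReal_mul (by positivity),
          ← ENNReal.ofReal_add (by positivity) (by positivity)]
        congr 1
        field_simp
      simp_rw [h2]
      rw [lintegral_add_left (hf.ennreal_ofReal.const_mul _), lintegral_const_mul _
        hf.ennreal_ofReal, hf1, lintegral_const_mul' _ _ ENNReal.ofReal_ne_top]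
      calc _ ≤ ENNReal.ofReal ((m + 1 : ℝ) / (m + 2)) * 1 + ENNReal.ofReal (1 / (m + 2 : ℝ)) * 1 := by
            gcongr
            exact lintegral_paretoDensity_le hα hw
        _ = 1 := by
            rw [mul_one, mul_one, ← ENNReal.ofReal_add (by positivity) (by positivity),
              ← ENNReal.ofReal_one]
            congr 1
            field_simp
            ring

theorem gpdSecondMoment_succ (m : ℕ) (s : ℝ) : gpdSecondMoment α A κ b f (m + 1) s =
    ∫⁻ x, ENNReal.ofReal (f x ^ 2 / gpdKernel α A κ b f m s x) *
      gpdSecondMoment α A κ b f m (s + x) := rfl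

theorem tailProb_succ (m : ℕ) (s : ℝ) : tailProb b f (m + 1) s =
    ∫⁻ x, ENNReal.ofReal (f x) * tailProb b f m (s + x) := rfl

theorem tailProb_le_one (hf1 : ∫⁻ x, ENNReal.ofReal (f x) = 1) (m : ℕ) (s : ℝ) :
    tailProb b f m s ≤ 1 := by
  induction m generalizing s with
  | zero => exact indicator_le_self _ _ _
  | succ m ih =>
    rw [tailProb_succ]
    calc _ ≤ ∫⁻ x, ENNReal.ofReal (f x) * 1 := by gcongr; exact ih _
      _ = 1 := by simp [hf1]

theorem one_le_tailProb (hf_supp : ∀ x ≤ (0 : ℝ), f x = 0)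
    (hf1 : ∫⁻ x, ENNReal.ofReal (f x) = 1) (m : ℕ) {s : ℝ} (hs : b < s) :
    1 ≤ tailProb b f m s := by
  induction m generalizing s with
  | zero => simp [tailProb, iterInt, hs]
  | succ m ih =>
    rw [tailProb_succ, ← hf1]
    refine lintegral_mono fun x => ?_
    rcases le_or_gt x 0 with hx | hx
    · simp [hf_supp x hx]
    · exact le_mul_of_one_le_right (zero_le) (ih (by linarith))

theorem tailProb_ge (hf : Measurable f) (hf_supp : ∀ x ≤ (0 : ℝ), f x = 0)
    (hf1 : ∫⁻ x, ENNReal.ofReal (f x) = 1) {t : ℝ} (ht0 : 0 ≤ t) (ht1 : t ≤ 1)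
    (ht : ∫⁻ x in Ioi b, ENNReal.ofReal (f x) = ENNReal.ofReal t)
    (m : ℕ) {s : ℝ} (hs : 0 ≤ s) :
    ENNReal.ofReal (1 - (1 - t) ^ m) ≤ tailProb b f m s := by
  induction m generalizing s with
  | zero => simp
  | succ m ih =>
    have hr1 : (1 - t) ^ m ≤ 1 := pow_le_one₀ (by linarith) (by linarith)
    have hr0 : 0 ≤ (1 - t) ^ m := pow_nonneg (by linarith) m
    have hpt : ∀ x, ENNReal.ofReal (f x) * ENNReal.ofReal (1 - (1 - t) ^ m) +
        ENNReal.ofReal ((1 - t) ^ m) * (Ioi b).indicator (fun x => ENNReal.ofReal (f x)) x ≤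
        ENNReal.ofReal (f x) * tailProb b f m (s + x) := by
      intro x
      rcases le_or_gt x 0 with hx | hx
      · simp [hf_supp x hx, indicator]
      · by_cases hxb : b < x
        · rw [indicator_of_mem (mem_Ioi.2 hxb), mul_comm (ENNReal.ofReal ((1 - t) ^ m)), ← mul_add,
            ← ENNReal.ofReal_add (by linarith) hr0]
          gcongr
          simpa using one_le_tailProb hf_supp hf1 m (by linarith : b < s + x)
        · rw [indicator_of_notMem (by simpa using hxb), mul_zero, add_zero]
          gcongr
          exact ih (by linarith)
    rw [tailProb_succ]
    refine le_trans (le_of_eq ?_) (lintegral_mono hpt)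
    rw [lintegral_add_left (hf.ennreal_ofReal.mul_const _), lintegral_mul_const _ hf.ennreal_ofReal,
      lintegral_const_mul' _ _ ENNReal.ofReal_ne_top, lintegral_indicator measurableSet_Ioi, ht, hf1,
      one_mul, ← ENNReal.ofReal_mul hr0, ← ENNReal.ofReal_add (by linarith) (by positivity)]
    congr 1
    ring

theorem sq_tailProb_le_gpdSecondMoment (hα : 0 < α) (hA : 0 ≤ A) (hκ : 0 < κ) (hf : Measurable f)
    (hf0 : ∀ x, 0 ≤ f x) (hf_supp : ∀ x ≤ (0 : ℝ), f x = 0)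
    (hf1 : ∫⁻ x, ENNReal.ofReal (f x) = 1) (m : ℕ) (s : ℝ) :
    tailProb b f m s ^ 2 ≤ gpdSecondMoment α A κ b f m s := by
  induction m generalizing s with
  | zero =>
    by_cases h : b < s <;> simp [tailProb, gpdSecondMoment, iterInt, h]
  | succ m ih =>
    have hV1 := tailProb_le_one (b := b) hf1
    have hVt : ∀ k s, tailProb b f k s ≠ ⊤ := fun k s => ((hV1 k s).trans_lt ENNReal.one_lt_top).ne
    have hzero : ∀ x, gpdKernel α A κ b f m s x = 0 → f x * (tailProb b f m (s + x)).toReal = 0 := by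
      intro x h
      rcases le_or_gt x 0 with hx | hx
      · simp [hf_supp x hx]
      cases m with
      | zero =>
        simp only [gpdKernel] at h
        split_ifs at h with h1 h2
        · simp [h]
        · unfold paretoDensity at h
          split_ifs at h with h3
          · have h4 : 0 < b - s := by linarith
            have : 0 < α * (b - s) ^ α * x ^ (-α - 1) := by positivity
            exact absurd h this.ne'
          · have : ¬ b < s + x := by linarith
            simp [tailProb, iterInt, this]
        · simp [h]
      | succ k =>
        simp only [gpdKernel] at h
        split_ifs at h with h1
        · simp [h]
        · have h3 := paretoDensity_nonneg hα (mul_nonneg hA (by linarith : 0 ≤ b - s)) x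
          have h4 := hf0 x
          rcases div_eq_zero_iff.1 h with h | h
          · have : (k + 1 : ℝ) * f x = 0 := by
              have : 0 ≤ (k + 1 : ℝ) * f x := by positivity
              linarith
            rcases mul_eq_zero.1 this with h5 | h5
            · have : (0 : ℝ) < k + 1 := by positivity
              linarith
            · simp [h5]
          · have : (0 : ℝ) < k + 2 := by positivity
            linarith
    set r := (tailProb b f (m + 1) s).toReal with hr
    have hr0 : 0 ≤ r := ENNReal.toReal_nonneg
    have hVr : tailProb b f (m + 1) s = ENNReal.ofReal r := (ENNReal.ofReal_toReal (hVt _ _)).symm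
    have hpt : ∀ x, ENNReal.ofReal (2 * r) * (ENNReal.ofReal (f x) * tailProb b f m (s + x)) ≤
        ENNReal.ofReal (f x ^ 2 / gpdKernel α A κ b f m s x) * gpdSecondMoment α A κ b f m (s + x) +
        ENNReal.ofReal (r ^ 2) * ENNReal.ofReal (gpdKernel α A κ b f m s x) := by
      intro x
      have hψ := gpdKernel_nonneg (κ := κ) (b := b) hα hA hf0 m s x
      have hfx := hf0 x
      refine le_trans ?_ (add_le_add_left (mul_le_mul_right (ih (s + x)) _) _)
      have hz := hzero x
      obtain ⟨v, hv, hv0⟩ : ∃ v : ℝ, tailProb b f m (s + x) = ENNReal.ofReal v ∧ 0 ≤ v :=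
        ⟨_, (ENNReal.ofReal_toReal (hVt _ _)).symm, ENNReal.toReal_nonneg⟩
      rw [hv, ENNReal.toReal_ofReal hv0] at hz
      rw [hv, ← ENNReal.ofReal_pow hv0, ← ENNReal.ofReal_mul hfx, ← ENNReal.ofReal_mul (by positivity),
        ← ENNReal.ofReal_mul (by positivity), ← ENNReal.ofReal_mul (by positivity),
        ← ENNReal.ofReal_add (by positivity) (by positivity)]
      refine ENNReal.ofReal_le_ofReal ?_
      generalize gpdKernel α A κ b f m s x = ψ at *
      rcases hψ.eq_or_lt with h0 | hpos
      · rw [hz h0.symm, ← h0]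
        simp
      · have h5 : 0 ≤ (f x * v - r * ψ) ^ 2 / ψ := by positivity
        have h6 : (f x * v - r * ψ) ^ 2 / ψ =
          f x ^ 2 / ψ * v ^ 2 + r ^ 2 * ψ - 2 * r * (f x * v) := by field_simp; ring
        linarith
    have hint := lintegral_mono (μ := volume) hpt
    have hψm : Measurable fun x => ENNReal.ofReal (r ^ 2) *
        ENNReal.ofReal (gpdKernel α A κ b f m s x) :=
      ((measurable_gpdKernel hf m).comp measurable_prodMk_left).ennreal_ofReal.const_mul _
    rw [lintegral_const_mul' _ _ ENNReal.ofReal_ne_top, ← tailProb_succ, hVr,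
      lintegral_add_right _ hψm,
      ← gpdSecondMoment_succ, lintegral_const_mul' _ _ ENNReal.ofReal_ne_top] at hint
    have h7 : ENNReal.ofReal (r ^ 2) + ENNReal.ofReal (r ^ 2) ≤
        gpdSecondMoment α A κ b f (m + 1) s + ENNReal.ofReal (r ^ 2) := by
      calc _ = ENNReal.ofReal (2 * r) * ENNReal.ofReal r := by
            rw [← ENNReal.ofReal_mul (by positivity), ← ENNReal.ofReal_add (by positivity)
              (by positivity)]
            congr 1; ring
        _ ≤ _ := hint
        _ ≤ gpdSecondMoment α A κ b f (m + 1) s + ENNReal.ofReal (r ^ 2) * 1 := by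
            gcongr
            exact lintegral_gpdKernel_le hα hA hf hf0 hf1 m s
        _ = _ := by rw [mul_one]
    rw [hVr, ← ENNReal.ofReal_pow hr0]
    exact (ENNReal.add_le_add_iff_right ENNReal.ofReal_ne_top).1 h7

theorem gpdSecondMoment_le_one_of_lt (hf_supp : ∀ x ≤ (0 : ℝ), f x = 0)
    (hf1 : ∫⁻ x, ENNReal.ofReal (f x) = 1) (m : ℕ) {s : ℝ} (hs : b < s) :
    gpdSecondMoment α A κ b f m s ≤ 1 := by
  induction m generalizing s with
  | zero => exact indicator_le_self _ _ _
  | succ m ih =>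
    rw [gpdSecondMoment_succ, ← hf1]
    refine lintegral_mono fun x => ?_
    rw [gpdKernel_of_lt hs]
    rcases le_or_gt x 0 with hx | hx
    · simp [hf_supp x hx]
    · have e : f x ^ 2 / f x = f x := by
        rcases eq_or_ne (f x) 0 with h | h
        · simp [h]
        · field_simp
      rw [e]
      exact mul_le_of_le_one_right zero_le (ih (by linarith))

theorem gpdSecondMoment_zero_le (s : ℝ) : gpdSecondMoment α A κ b f 0 s ≤ 1 :=
  indicator_le_self _ _ _

theorem gpdSecondMoment_one_le (hα : 0 < α) (hκ : 0 < κ) {u : ℝ} (hu : κ ≤ u)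
    (hint : IntegrableOn (fun x => f x ^ 2 * x ^ (α + 1)) (Ioi u)) :
    gpdSecondMoment α A κ b f 1 (b - u) ≤
      ENNReal.ofReal ((∫ x in Ioi u, f x ^ 2 * x ^ (α + 1)) / α * u ^ (-α)) := by
  have hu0 : 0 < u := hκ.trans_le hu
  have hpt : ∀ x, ENNReal.ofReal (f x ^ 2 / gpdKernel α A κ b f 0 (b - u) x) *
      gpdSecondMoment α A κ b f 0 (b - u + x) ≤
      (Ioi u).indicator (fun x => ENNReal.ofReal (α⁻¹ * u ^ (-α) * (f x ^ 2 * x ^ (α + 1)))) x := by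
    intro x
    by_cases hx : u < x
    · have hx0 : 0 < x := hu0.trans hx
      have h1 : gpdKernel α A κ b f 0 (b - u) x = α * u ^ α * x ^ (-α - 1) := by
        have e1 : ¬ b < b - u := by linarith
        have e2 : b - u ≤ b - κ := by linarith
        simp only [gpdKernel, if_neg e1, if_pos e2, paretoDensity, sub_sub_cancel, if_pos hx]
      rw [indicator_of_mem (mem_Ioi.2 hx), h1]
      refine (mul_le_of_le_one_right zero_le (gpdSecondMoment_zero_le _)).trans
        (ENNReal.ofReal_le_ofReal (le_of_eq ?_))
      have e3 : -α - 1 = -(α + 1) := by ring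
      rw [e3, Real.rpow_neg hx0.le, Real.rpow_neg hu0.le]
      have := Real.rpow_pos_of_pos hu0 α
      have := Real.rpow_pos_of_pos hx0 (α + 1)
      field_simp
    · have : ¬ b < b - u + x := by linarith
      simp [gpdSecondMoment, iterInt, this]
  rw [gpdSecondMoment_succ]
  refine (lintegral_mono hpt).trans (le_of_eq ?_)
  rw [lintegral_indicator measurableSet_Ioi, ← ofReal_integral_eq_lintegral_ofReal
    (hint.const_mul _), integral_const_mul]
  · congr 1
    field_simp
  · filter_upwards [ae_restrict_mem measurableSet_Ioi] with x hx
    have : 0 < x := hu0.trans hx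
    positivity

theorem gpdSecondMoment_one_le_two (hf0 : ∀ x, 0 ≤ f x) (hf1 : ∫⁻ x, ENNReal.ofReal (f x) = 1)
    (hκ2 : ∀ u, κ ≤ u → gpdSecondMoment α A κ b f 1 (b - u) ≤ 2) (s : ℝ) :
    gpdSecondMoment α A κ b f 1 s ≤ 2 := by
  rcases le_or_gt κ (b - s) with h | h
  · simpa using hκ2 (b - s) h
  have hk : ∀ x, gpdKernel α A κ b f 0 s x = f x := by
    intro x
    have : ¬ s ≤ b - κ := by linarith
    simp [gpdKernel, this]
  rw [gpdSecondMoment_succ]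
  refine le_trans ?_ one_le_two
  rw [← hf1]
  refine lintegral_mono fun x => ?_
  rw [hk]
  refine (mul_le_of_le_one_right zero_le (gpdSecondMoment_zero_le _)).trans
    (ENNReal.ofReal_le_ofReal ?_)
  rcases (hf0 x).eq_or_lt with h | h
  · simp [← h]
  · apply le_of_eq; field_simp

theorem sq_div_gpdKernel_succ_le (hα : 0 < α) (hA : 0 ≤ A) (hf0 : ∀ x, 0 ≤ f x)
    (m : ℕ) (s x : ℝ) :
    f x ^ 2 / gpdKernel α A κ b f (m + 1) s x ≤ ((m + 2 : ℝ) / (m + 1)) * f x := by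
  have hfx := hf0 x
  have hge : f x * ((m + 1 : ℝ) / (m + 2)) ≤ gpdKernel α A κ b f (m + 1) s x := by
    simp only [gpdKernel]
    split_ifs with h
    · refine mul_le_of_le_one_right hfx ?_
      rw [div_le_one (by positivity)]
      linarith
    · have := paretoDensity_nonneg hα (mul_nonneg hA (by linarith : 0 ≤ b - s)) x
      rw [mul_div_assoc', mul_comm]
      gcongr
      linarith
  rcases hfx.eq_or_lt with h | h
  · simp [← h]
  · have h2 : 0 < f x * ((m + 1 : ℝ) / (m + 2)) := by positivity
    calc f x ^ 2 / gpdKernel α A κ b f (m + 1) s x ≤ f x ^ 2 / (f x * ((m + 1 : ℝ) / (m + 2))) := by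
          gcongr
      _ = _ := by field_simp

theorem gpdSecondMoment_le (hα : 0 < α) (hA : 0 ≤ A) (hf : Measurable f) (hf0 : ∀ x, 0 ≤ f x)
    (hf1 : ∫⁻ x, ENNReal.ofReal (f x) = 1)
    (h1 : ∀ s, gpdSecondMoment α A κ b f 1 s ≤ 2) (m : ℕ) (s : ℝ) :
    gpdSecondMoment α A κ b f (m + 1) s ≤ ENNReal.ofReal (2 * (m + 1)) := by
  induction m generalizing s with
  | zero => simpa using h1 s
  | succ m ih =>
    rw [gpdSecondMoment_succ]
    calc _ ≤ ∫⁻ x, ENNReal.ofReal (((m + 2 : ℝ) / (m + 1)) * f x) *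
          ENNReal.ofReal (2 * (m + 1)) := by
          gcongr with x
          · exact sq_div_gpdKernel_succ_le hα hA hf0 m s x
          · exact ih _
      _ = _ := by
          simp_rw [ENNReal.ofReal_mul (show (0 : ℝ) ≤ (m + 2) / (m + 1) by positivity)]
          rw [lintegral_mul_const _ (hf.ennreal_ofReal.const_mul _), lintegral_const_mul _
            hf.ennreal_ofReal, hf1, mul_one, ← ENNReal.ofReal_mul (by positivity)]
          congr 1
          push_cast
          field_simp
          ring

/-- One backward step of the second moment recursion. Here `θ` separates small increments,
increments of order `u` that stay below the level `A * u`, and increments close to or beyond the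
remaining distance `u`. -/
theorem gpdSecondMoment_step (hα : 0 < α) (hA1 : A < 1) (hf : Measurable f)
    (hf0 : ∀ x, 0 ≤ f x) (hf_supp : ∀ x ≤ (0 : ℝ), f x = 0)
    (hf1 : ∫⁻ x, ENNReal.ofReal (f x) = 1) {F : ℝ → ℝ} (hF : Antitone F) (hF0 : ∀ x, 0 ≤ F x)
    {m : ℕ} {M c u θ D : ℝ} (hM : 0 ≤ M) (hc : 0 ≤ c) (hu : 0 < u) (hθ : 0 < θ) (hθA : θ ≤ A)
    (hW : ∀ s, gpdSecondMoment α A κ b f (m + 1) s ≤ ENNReal.ofReal M)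
    (hWc : ∀ v, (1 - A) * u ≤ v →
      gpdSecondMoment α A κ b f (m + 1) (b - v) ≤ ENNReal.ofReal (c * F v ^ 2))
    (hD0 : 0 ≤ D) (hD : ∀ x ∈ Icc ((1 - θ) * u) u, f x ≤ D)
    (hint : IntegrableOn (fun x => f x ^ 2 * x ^ (α + 1)) (Ioi (θ * u))) :
    gpdSecondMoment α A κ b f (m + 2) (b - u) ≤ ENNReal.ofReal (
      ((m + 2 : ℝ) / (m + 1)) * c * (F (θ * u) ^ 2 + D * u * F ((1 - A) * u) ^ 2) +
      (m + 2) / α * (θ * u) ^ (-α) * (M * ((∫ x in Ioi (θ * u), f x ^ 2 * x ^ (α + 1)) -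
        ∫ x in Ioi u, f x ^ 2 * x ^ (α + 1)) + ∫ x in Ioi u, f x ^ 2 * x ^ (α + 1))) := by
  have hA0 : 0 < A := hθ.trans_le hθA
  have hθu : 0 < θ * u := by positivity
  have hθu1 : θ * u ≤ u := by nlinarith
  set k₁ : ℝ := (m + 2 : ℝ) / (m + 1) with hk₁
  have hk₁0 : 0 ≤ k₁ := by positivity
  set K : ℝ := (m + 2) / α * (θ * u) ^ (-α) with hK
  have hK0 : 0 ≤ K := by positivity
  have hR0 : ∀ x, 0 < x → 0 ≤ f x ^ 2 * x ^ (α + 1) := fun x hx => by positivity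
  have hbig : ∀ x, A * u < x → f x ^ 2 / gpdKernel α A κ b f (m + 1) (b - u) x ≤
      K * (f x ^ 2 * x ^ (α + 1)) := by
    intro x hx
    have hAu : 0 < A * u := by positivity
    have hx0 : 0 < x := hAu.trans hx
    have hfx := hf0 x
    have e1 : ¬ b < b - u := by linarith
    have hge : α * (θ * u) ^ α * x ^ (-(α + 1)) / (m + 2) ≤
        gpdKernel α A κ b f (m + 1) (b - u) x := by
      simp only [gpdKernel, if_neg e1, paretoDensity, sub_sub_cancel, if_pos hx]
      have e2 : -α - 1 = -(α + 1) := by ring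
      rw [e2]
      have h3 : (θ * u) ^ α ≤ (A * u) ^ α := by gcongr
      have h4 : α * (θ * u) ^ α * x ^ (-(α + 1)) ≤ α * (A * u) ^ α * x ^ (-(α + 1)) := by gcongr
      gcongr
      have : 0 ≤ (m + 1 : ℝ) * f x := by positivity
      linarith
    have hpos : 0 < α * (θ * u) ^ α * x ^ (-(α + 1)) / (m + 2) := by positivity
    calc _ ≤ f x ^ 2 / (α * (θ * u) ^ α * x ^ (-(α + 1)) / (m + 2)) := by gcongr
      _ = K * (f x ^ 2 * x ^ (α + 1)) := by
          rw [hK, Real.rpow_neg hx0.le, Real.rpow_neg hθu.le]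
          have := Real.rpow_pos_of_pos hθu α
          have := Real.rpow_pos_of_pos hx0 (α + 1)
          field_simp
  have hR' : Measurable fun x => ENNReal.ofReal (f x ^ 2 * x ^ (α + 1)) :=
    ((hf.pow_const 2).mul (measurable_id.pow_const _)).ennreal_ofReal
  have hpt : ∀ x, ENNReal.ofReal (f x ^ 2 / gpdKernel α A κ b f (m + 1) (b - u) x) *
      gpdSecondMoment α A κ b f (m + 1) (b - u + x) ≤
      ENNReal.ofReal (k₁ * c * F (θ * u) ^ 2) * ENNReal.ofReal (f x) +
      (Ioc 0 u).indicator (fun _ => ENNReal.ofReal (k₁ * c * (D * F ((1 - A) * u) ^ 2))) x +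
      (ENNReal.ofReal (K * M) * (Ioc (θ * u) u).indicator
          (fun x => ENNReal.ofReal (f x ^ 2 * x ^ (α + 1))) x +
        ENNReal.ofReal K * (Ioi u).indicator
          (fun x => ENNReal.ofReal (f x ^ 2 * x ^ (α + 1))) x) := by
    intro x
    have hfx := hf0 x
    rcases le_or_gt x 0 with hx0 | hx0
    · simp [hf_supp x hx0]
    have hsmall := sq_div_gpdKernel_succ_le (κ := κ) (b := b) hα hA0.le hf0 m (b - u) x
    have e0 : b - u + x = b - (u - x) := by ring
    rcases le_or_gt x (A * u) with hxA | hxA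
    · have hv : (1 - A) * u ≤ u - x := by linarith
      have hcW := hWc (u - x) hv
      rw [← e0] at hcW
      rcases le_or_gt x ((1 - θ) * u) with hxη | hxη
      · refine le_trans ?_ (le_self_add.trans le_self_add)
        rw [← ENNReal.ofReal_mul (by have := hF0 (θ * u); positivity)]
        refine (mul_le_mul' (ENNReal.ofReal_le_ofReal hsmall) hcW).trans ?_
        rw [← ENNReal.ofReal_mul (by positivity)]
        refine ENNReal.ofReal_le_ofReal ?_
        have h5 : F (u - x) ≤ F (θ * u) := hF (by linarith)
        have h6 : F (u - x) ^ 2 ≤ F (θ * u) ^ 2 := pow_le_pow_left₀ (hF0 _) h5 2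
        calc k₁ * f x * (c * F (u - x) ^ 2) ≤ k₁ * f x * (c * F (θ * u) ^ 2) := by gcongr
          _ = _ := by ring
      · have hxu : x ≤ u := by nlinarith
        refine le_trans ?_ (le_add_self.trans le_self_add)
        rw [indicator_of_mem (show x ∈ Ioc 0 u from ⟨hx0, hxu⟩)]
        refine (mul_le_mul' (ENNReal.ofReal_le_ofReal hsmall) hcW).trans ?_
        rw [← ENNReal.ofReal_mul (by positivity)]
        refine ENNReal.ofReal_le_ofReal ?_
        have h5 : F (u - x) ≤ F ((1 - A) * u) := hF hv
        have h6 : F (u - x) ^ 2 ≤ F ((1 - A) * u) ^ 2 := pow_le_pow_left₀ (hF0 _) h5 2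
        have h7 := hD x ⟨hxη.le, hxu⟩
        calc k₁ * f x * (c * F (u - x) ^ 2) ≤ k₁ * D * (c * F ((1 - A) * u) ^ 2) := by gcongr
          _ = _ := by ring
    · have hb := ENNReal.ofReal_le_ofReal (hbig x hxA)
      have hRx := hR0 x hx0
      rcases le_or_gt x u with hxu | hxu
      · refine le_trans ?_ (le_self_add.trans le_add_self)
        have hθx : θ * u < x := by nlinarith
        rw [indicator_of_mem (show x ∈ Ioc (θ * u) u from ⟨hθx, hxu⟩)]
        refine (mul_le_mul' hb (hW _)).trans (le_of_eq ?_)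
        rw [← ENNReal.ofReal_mul (by positivity), ← ENNReal.ofReal_mul (by positivity)]
        congr 1
        ring
      · refine le_trans ?_ (le_add_self.trans le_add_self)
        rw [indicator_of_mem (mem_Ioi.2 hxu)]
        refine (mul_le_of_le_one_right zero_le (gpdSecondMoment_le_one_of_lt hf_supp hf1 _
          (by linarith))).trans (hb.trans (le_of_eq ?_))
        rw [ENNReal.ofReal_mul hK0]
  have hintu : IntegrableOn (fun x => f x ^ 2 * x ^ (α + 1)) (Ioi u) :=
    hint.mono_set (Ioi_subset_Ioi hθu1)
  have hintc : IntegrableOn (fun x => f x ^ 2 * x ^ (α + 1)) (Ioc (θ * u) u) :=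
    hint.mono_set Ioc_subset_Ioi_self
  have hsplit : ∫ x in Ioc (θ * u) u, f x ^ 2 * x ^ (α + 1) =
      (∫ x in Ioi (θ * u), f x ^ 2 * x ^ (α + 1)) - ∫ x in Ioi u, f x ^ 2 * x ^ (α + 1) := by
    rw [eq_sub_iff_add_eq, ← setIntegral_union (Ioc_disjoint_Ioi le_rfl) measurableSet_Ioi
      hintc hintu, Ioc_union_Ioi_eq_Ioi hθu1]
  have hI1 : 0 ≤ ∫ x in Ioc (θ * u) u, f x ^ 2 * x ^ (α + 1) :=
    setIntegral_nonneg measurableSet_Ioc fun x hx => hR0 x (hθu.trans hx.1)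
  have hI2 : 0 ≤ ∫ x in Ioi u, f x ^ 2 * x ^ (α + 1) :=
    setIntegral_nonneg measurableSet_Ioi fun x hx => hR0 x (hu.trans hx)
  rw [gpdSecondMoment_succ]
  refine (lintegral_mono hpt).trans (le_of_eq ?_)
  have hFA := hF0 ((1 - A) * u)
  have hFθ := hF0 (θ * u)
  have hmeas : Measurable fun x => ENNReal.ofReal (k₁ * c * F (θ * u) ^ 2) * ENNReal.ofReal (f x) +
      (Ioc 0 u).indicator (fun _ => ENNReal.ofReal (k₁ * c * (D * F ((1 - A) * u) ^ 2))) x :=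
    (hf.ennreal_ofReal.const_mul _).add (measurable_const.indicator measurableSet_Ioc)
  rw [lintegral_add_left hmeas,
    lintegral_add_left (hf.ennreal_ofReal.const_mul _),
    lintegral_add_left ((hR'.indicator measurableSet_Ioc).const_mul _),
    lintegral_const_mul _ hf.ennreal_ofReal, hf1, mul_one,
    lintegral_indicator measurableSet_Ioc, setLIntegral_const, Real.volume_Ioc, sub_zero,
    lintegral_const_mul _ (hR'.indicator measurableSet_Ioc),
    lintegral_const_mul _ (hR'.indicator measurableSet_Ioi),
    lintegral_indicator measurableSet_Ioc, lintegral_indicator measurableSet_Ioi,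
    ← ofReal_integral_eq_lintegral_ofReal hintc, ← ofReal_integral_eq_lintegral_ofReal hintu,
    ← ENNReal.ofReal_mul (by positivity), ← ENNReal.ofReal_mul (by positivity),
    ← ENNReal.ofReal_mul (by positivity), ← ENNReal.ofReal_add (by positivity) (by positivity),
    ← ENNReal.ofReal_add (by positivity) (by positivity),
    ← ENNReal.ofReal_add (by positivity) (by positivity), hsplit]
  · congr 1
    ring
  · filter_upwards [ae_restrict_mem measurableSet_Ioi] with x hx using hR0 x (hu.trans hx)
  · filter_upwards [ae_restrict_mem measurableSet_Ioc] with x hx using hR0 x (hθu.trans hx.1)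

end Mixture

section Asymptotics

theorem abs_le_of_slowly_varying {l : ℝ → ℝ} (hl : AEMeasurable l volume)
    (hlim : ∀ x : ℝ, 0 < x → Tendsto (fun u => l (u * x) - l u) atTop (nhds 0))
    {ε : ℝ} (hε : 0 < ε) : ∃ C, ∀ᶠ u in atTop, |l u| ≤ C + ε * Real.log u := by
  have hneg : ∀ x : ℝ, 0 < x → Tendsto (fun u => (-l) (u * x) - (-l) u) atTop (nhds 0) := by
    intro x hx
    have := (hlim x hx).neg
    rw [neg_zero] at this
    refine this.congr fun u => ?_
    simp only [Pi.neg_apply]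
    ring
  obtain ⟨U, hU1, hU2, hU⟩ := ((potter_bound_of_slowly_varying hl hlim hε).and
    ((potter_bound_of_slowly_varying hl.neg hneg hε).and (eventually_ge_atTop 1))).exists
  refine ⟨|l U| + ε * Real.log 2, ?_⟩
  filter_upwards [eventually_ge_atTop U] with u hu
  have hU0 : 0 < U := by linarith
  have hy : 1 ≤ u / U := by rwa [one_le_div hU0]
  have h1 := hU1 _ hy
  have h2 := hU2 _ hy
  simp only [Pi.neg_apply] at h2
  rw [mul_div_cancel₀ _ hU0.ne'] at h1 h2
  have h3 : Real.log (u / U) ≤ Real.log u := by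
    refine Real.log_le_log (by positivity) ?_
    exact div_le_self (by linarith) hU
  have h4 := mul_le_mul_of_nonneg_left h3 hε.le
  have h5 := le_abs_self (l U)
  have h6 := neg_abs_le (l U)
  rw [abs_le]
  constructor <;> linarith

theorem mul_pow_tendsto_atTop {n : ℕ} (hn : 2 ≤ n) {δ c₁ : ℝ} (hδ : 0 < δ) (hc₁ : 0 < c₁)
    {τ : ℝ → ℝ} (hτ : ∀ᶠ b in atTop, c₁ * b ^ (-(1 / (2 * ((n : ℝ) - 1))) + δ) ≤ τ b) :
    Tendsto (fun b => b * τ b ^ (n - 1)) atTop atTop := by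
  have hn1 : (0 : ℝ) < (n : ℝ) - 1 := by
    have : (2 : ℝ) ≤ n := by exact_mod_cast hn
    linarith
  set e := -(1 / (2 * ((n : ℝ) - 1))) + δ with he
  have hcast : ((n - 1 : ℕ) : ℝ) = (n : ℝ) - 1 := by
    rw [Nat.cast_sub (by omega)]; simp
  have hexp : 0 < 1 + e * ((n : ℝ) - 1) := by
    have : e * ((n : ℝ) - 1) = -(1 / 2) + δ * ((n : ℝ) - 1) := by
      rw [he]; field_simp
    rw [this]
    have := mul_pos hδ hn1
    linarith
  have h := (tendsto_rpow_atTop hexp).const_mul_atTop (pow_pos hc₁ (n - 1))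
  refine tendsto_atTop_mono' _ ?_ h
  filter_upwards [hτ, eventually_gt_atTop 0] with b hb hb0
  have h1 : (c₁ * b ^ e) ^ (n - 1) ≤ τ b ^ (n - 1) := pow_le_pow_left₀ (by positivity) hb _
  rw [mul_pow, ← Real.rpow_mul_natCast hb0.le, hcast] at h1
  rw [Real.rpow_add hb0, Real.rpow_one]
  calc _ = b * (c₁ ^ (n - 1) * b ^ (e * ((n : ℝ) - 1))) := by ring
    _ ≤ _ := by gcongr

theorem sq_tail_scaled_le {α : ℝ} (hα : 0 < α) {F : ℝ → ℝ} (hF : Antitone F)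
    (hF0 : ∀ u, 0 < F u)
    (hF_rv : ∀ θ : ℝ, 0 < θ → Tendsto (fun u => F (θ * u) / F u) atTop (nhds (θ ^ (-α))))
    {n : ℕ} (hn : 2 ≤ n) {δ c₁ : ℝ} (hδ : 0 < δ) (hδ' : δ < 1 / (2 * ((n : ℝ) - 1)))
    (hc₁ : 0 < c₁) {τ : ℝ → ℝ} (hτ01 : ∀ b, τ b ∈ Ioo (0 : ℝ) 1)
    (hτ : ∀ᶠ b in atTop, c₁ * b ^ (-(1 / (2 * ((n : ℝ) - 1))) + δ) ≤ τ b)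
    {ε : ℝ} (hε : 0 < ε) :
    ∀ᶠ b in atTop, ∀ u, b * τ b ^ (n - 2) ≤ u → F (τ b * u) ^ 2 ≤ ε * F u := by
  have hn2 : (2 : ℝ) ≤ n := by exact_mod_cast hn
  have hn1 : (0 : ℝ) < (n : ℝ) - 1 := by linarith
  set e := -(1 / (2 * ((n : ℝ) - 1))) + δ with he
  have hfrac : n * (1 / (2 * ((n : ℝ) - 1))) ≤ 1 := by
    rw [mul_one_div, div_le_one (by positivity)]
    linarith
  have hne : -1 + n * δ ≤ n * e := by rw [he]; linarith
  have hnδ : n * δ < 1 := by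
    have : n * δ < n * (1 / (2 * ((n : ℝ) - 1))) := by gcongr
    linarith
  have hl : AEMeasurable (fun u => Real.log (F u) + α * Real.log u) volume :=
    ((Real.measurable_log.comp hF.measurable).add
      (Real.measurable_log.const_mul α)).aemeasurable
  have hlim : ∀ x : ℝ, 0 < x → Tendsto (fun u => (Real.log (F (u * x)) + α * Real.log (u * x)) -
      (Real.log (F u) + α * Real.log u)) atTop (nhds 0) := by
    intro x hx
    have h := ((hF_rv x hx).log (Real.rpow_pos_of_pos hx _).ne').add_const (α * Real.log x)
    rw [Real.log_rpow hx, neg_mul, neg_add_cancel] at h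
    refine h.congr' ?_
    filter_upwards [eventually_gt_atTop 0] with u hu
    rw [Real.log_div (hF0 _).ne' (hF0 _).ne', Real.log_mul hu.ne' hx.ne', mul_comm x u]
    ring
  set ε₀ := α * (n * δ) / 6 with hε₀
  have hε₀0 : 0 < ε₀ := by positivity
  have hε₀α : 3 * ε₀ < α := by
    have := mul_lt_mul_of_pos_left hnδ hα
    rw [hε₀]
    linarith
  obtain ⟨C, hC⟩ := abs_le_of_slowly_varying hl hlim hε₀0
  have hκ := mul_pow_tendsto_atTop hn hδ hc₁ hτ
  have hfin : ∀ᶠ b in atTop,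
      3 * C - α * n * Real.log c₁ - Real.log ε ≤ (α * (n * δ) / 2) * Real.log b :=
    (Real.tendsto_log_atTop.const_mul_atTop (by positivity)).eventually_ge_atTop _
  filter_upwards [hκ.eventually (eventually_forall_ge_atTop.2 hC), hτ, hfin,
    eventually_ge_atTop 1] with b h1 h2 h3 hb1 u hu
  have hb : 0 < b := by linarith
  obtain ⟨hτ0, hτ1⟩ := hτ01 b
  have hu0 : 0 < u := lt_of_lt_of_le (by positivity) hu
  have hpow : τ b ^ (n - 1) = τ b * τ b ^ (n - 2) := by
    rw [← pow_succ']
    congr 1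
    omega
  have hv : b * τ b ^ (n - 1) ≤ τ b * u := by
    rw [hpow]
    calc _ = τ b * (b * τ b ^ (n - 2)) := by ring
      _ ≤ _ := by gcongr
  have hvu : τ b * u ≤ u := mul_le_of_le_one_left hu0.le hτ1.le
  have a1 := (abs_le.1 (h1 _ hv)).2
  have a2 := (abs_le.1 (h1 u (hv.trans hvu))).1
  rw [Real.log_mul hτ0.ne' hu0.ne'] at a1
  have a3 : Real.log b + ((n : ℝ) - 2) * Real.log (τ b) ≤ Real.log u := by
    have h := Real.log_le_log (by positivity) hu
    rw [Real.log_mul hb.ne' (by positivity), Real.log_pow, Nat.cast_sub hn] at h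
    exact_mod_cast h
  have a4 : Real.log c₁ + e * Real.log b ≤ Real.log (τ b) := by
    have h := Real.log_le_log (by positivity) h2
    rwa [Real.log_mul hc₁.ne' (by positivity), Real.log_rpow hb] at h
  have a5 : Real.log (τ b) ≤ 0 := Real.log_nonpos hτ0.le hτ1.le
  rw [← Real.log_le_log_iff (pow_pos (hF0 _) 2) (mul_pos hε (hF0 _)), Real.log_pow,
    Real.log_mul hε.ne' (hF0 _).ne']
  push_cast
  generalize Real.log (τ b) = Lτ at *
  generalize Real.log u = Lu at *
  have hlogb : 0 ≤ Real.log b := Real.log_nonneg hb1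
  have b1 : (3 * ε₀ - α) * Lu ≤ (3 * ε₀ - α) * (Real.log b + ((n : ℝ) - 2) * Lτ) :=
    mul_le_mul_of_nonpos_left a3 (by linarith)
  have b2 : (2 * ε₀ + 3 * ε₀ * ((n : ℝ) - 2)) * Lτ ≤ 0 :=
    mul_nonpos_of_nonneg_of_nonpos (by nlinarith) a5
  have b3 : α * n * (Real.log c₁ + e * Real.log b) ≤ α * n * Lτ := by gcongr
  have b4 : (-1 + n * δ) * (α * Real.log b) ≤ n * e * (α * Real.log b) := by gcongr
  have b5 : 3 * ε₀ * Real.log b = α * (n * δ) / 2 * Real.log b := by rw [hε₀]; ring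
  linarith

theorem tendsto_geom_sum_one_sub {n : ℕ} :
    Tendsto (fun t : ℝ => ∑ i ∈ Finset.range n, (1 - t) ^ i) (nhds 0) (nhds n) := by
  have h : Continuous fun t : ℝ => ∑ i ∈ Finset.range n, (1 - t) ^ i := by fun_prop
  simpa using h.tendsto 0

theorem exists_step_parameter (α : ℝ) (k : ℕ) {c : ℝ} (hc : ((k : ℝ) + 2) ^ 2 < c) :
    ∃ θ : ℝ, 1 / 2 < θ ∧ θ < 1 ∧
      ((k + 2 : ℝ) / (k + 1)) * ((k + 1) ^ 2 * θ⁻¹) * (θ ^ (-α)) ^ 2 +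
        (k + 2) * θ ^ (-α) * (2 * (k + 1) * (θ ^ (-α) - 1) + 1) < c := by
  have h1 : Tendsto (fun θ : ℝ => θ ^ (-α)) (nhds 1) (nhds 1) := by
    have := (Real.continuousAt_rpow_const (1 : ℝ) (-α) (Or.inl one_ne_zero)).tendsto
    simpa using this
  have h2 : Tendsto (fun θ : ℝ => θ⁻¹) (nhds 1) (nhds 1) := by
    simpa using (continuousAt_inv₀ (one_ne_zero (α := ℝ))).tendsto
  have h3 := (((h2.const_mul (((k : ℝ) + 1) ^ 2)).const_mul ((k + 2 : ℝ) / (k + 1))).mul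
    (h1.pow 2)).add ((h1.const_mul ((k : ℝ) + 2)).mul
      (((h1.sub_const 1).const_mul (2 * ((k : ℝ) + 1))).add_const 1))
  have e : ((k + 2 : ℝ) / (k + 1)) * ((k + 1) ^ 2 * 1) * 1 ^ 2 +
      ((k : ℝ) + 2) * 1 * (2 * ((k : ℝ) + 1) * (1 - 1) + 1) = ((k : ℝ) + 2) ^ 2 := by
    field_simp
    ring
  rw [e] at h3
  have h4 := (h3.eventually (gt_mem_nhds hc)).filter_mono (nhdsWithin_le_nhds (s := Iio 1))
  have h5 : ∀ᶠ θ : ℝ in nhdsWithin 1 (Iio 1), 1 / 2 < θ :=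
    (lt_mem_nhds (by norm_num)).filter_mono nhdsWithin_le_nhds
  have h6 : ∀ᶠ θ : ℝ in nhdsWithin 1 (Iio 1), θ < 1 := eventually_mem_nhdsWithin
  obtain ⟨θ, a1, a2, a3⟩ := (h5.and (h6.and h4)).exists
  exact ⟨θ, a1, a2, a3⟩

/-- Uniform asymptotic upper bound for the conditional second moments. -/
theorem eventually_gpdSecondMoment_le {α : ℝ} (hα : 0 < α) {f F A : ℝ → ℝ} (hf : Measurable f)
    (hf0 : ∀ x, 0 ≤ f x) (hf_supp : ∀ x ≤ (0 : ℝ), f x = 0)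
    (hf1 : ∫⁻ x, ENNReal.ofReal (f x) = 1) (hF : Antitone F) (hF0 : ∀ u, 0 < F u)
    (hF1 : ∀ u, F u ≤ 1)
    (hF_rv : ∀ θ : ℝ, 0 < θ → Tendsto (fun u => F (θ * u) / F u) atTop (nhds (θ ^ (-α))))
    (hint : ∀ᶠ u in atTop, IntegrableOn (fun x => f x ^ 2 * x ^ (α + 1)) (Ioi u))
    (hsq : Tendsto (fun u => (∫ x in Ioi u, f x ^ 2 * x ^ (α + 1)) / α * u ^ (-α) / F u ^ 2)
      atTop (nhds 1))
    (hdens : ∀ η : ℝ, 0 < η → η < 1 → ∃ C : ℝ, 0 < C ∧ ∀ᶠ u in atTop, ∀ x ∈ Icc (η * u) u,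
      f x ≤ C * F u / u)
    {n : ℕ} (hA01 : ∀ b, A b ∈ Ioo (0 : ℝ) 1)
    (hA1 : Tendsto A atTop (nhds 1))
    (hκ : Tendsto (fun b => b * (1 - A b) ^ (n - 1)) atTop atTop)
    (htail : ∀ ε : ℝ, 0 < ε → ∀ᶠ b in atTop, ∀ u, b * (1 - A b) ^ (n - 2) ≤ u →
      F ((1 - A b) * u) ^ 2 ≤ ε * F u)
    (k : ℕ) (hk : k < n) {c : ℝ} (hc : ((k : ℝ) + 1) ^ 2 < c) :
    ∀ᶠ b in atTop, ∀ u, b * (1 - A b) ^ (n - 1 - k) ≤ u →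
      gpdSecondMoment α (A b) (b * (1 - A b) ^ (n - 1)) b f (k + 1) (b - u) ≤
        ENNReal.ofReal (c * F u ^ 2) := by
  set R : ℝ → ℝ := fun u => ∫ x in Ioi u, f x ^ 2 * x ^ (α + 1) with hR
  have hbase : ∀ c : ℝ, 1 < c → ∀ᶠ b in atTop, ∀ u, b * (1 - A b) ^ (n - 1) ≤ u →
      gpdSecondMoment α (A b) (b * (1 - A b) ^ (n - 1)) b f 1 (b - u) ≤
        ENNReal.ofReal (c * F u ^ 2) := by
    intro c hc
    have h1 := (hsq.eventually (gt_mem_nhds hc)).and hint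
    filter_upwards [hκ.eventually (eventually_forall_ge_atTop.2 h1), hκ.eventually_gt_atTop 0]
      with b hb hκ0 u hu
    obtain ⟨h2, h3⟩ := hb u hu
    refine (gpdSecondMoment_one_le hα hκ0 hu h3).trans (ENNReal.ofReal_le_ofReal ?_)
    rw [div_lt_iff₀ (pow_pos (hF0 u) 2)] at h2
    exact h2.le
  induction k generalizing c with
  | zero =>
    simp only [Nat.cast_zero, zero_add, one_pow] at hc
    simpa using hbase c hc
  | succ k ih =>
    push_cast at hc
    have hc' : ((k : ℝ) + 2) ^ 2 < c := by
      have : (k : ℝ) + 1 + 1 = k + 2 := by ring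
      rwa [this] at hc
    obtain ⟨θ, hθ2, hθ1, hθc⟩ := exists_step_parameter α k hc'
    have hθ0 : 0 < θ := by linarith
    set c₁ : ℝ := (k + 1) ^ 2 * θ⁻¹ with hc₁
    have hc₁' : ((k : ℝ) + 1) ^ 2 < c₁ := by
      rw [hc₁]
      exact lt_mul_of_one_lt_right (by positivity) ((one_lt_inv₀ hθ0).2 hθ1)
    have hc₁0 : 0 < c₁ := by positivity
    obtain ⟨C, hC0, hC⟩ := hdens (1 - θ) (by linarith) (by linarith)
    set ρ : ℝ → ℝ := fun u => R (θ * u) / α * u ^ (-α) / F u ^ 2 with hρ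
    set r : ℝ → ℝ := fun u => R u / α * u ^ (-α) / F u ^ 2 with hr
    have hρ_lim : Tendsto ρ atTop (nhds (θ ^ (-α))) := by
      have h1 := ((hsq.comp (tendsto_id.const_mul_atTop hθ0)).mul
        ((hF_rv θ hθ0).pow 2)).const_mul (θ ^ α)
      have e : θ ^ α * (1 * (θ ^ (-α)) ^ 2) = θ ^ (-α) := by
        rw [Real.rpow_neg hθ0.le]
        have := Real.rpow_pos_of_pos hθ0 α
        field_simp
      rw [e] at h1
      refine h1.congr' ?_
      filter_upwards [eventually_gt_atTop 0] with u hu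
      have := hF0 u
      have := hF0 (θ * u)
      simp only [Function.comp, id, hρ, hr, hR]
      rw [Real.mul_rpow hθ0.le hu.le, Real.rpow_neg hθ0.le]
      have := Real.rpow_pos_of_pos hθ0 α
      field_simp
    set Q : ℝ := ((k + 2 : ℝ) / (k + 1)) * c₁ * (θ ^ (-α)) ^ 2 +
        (k + 2) * θ ^ (-α) * (2 * (k + 1) * (θ ^ (-α) - 1) + 1) with hQ
    have hlim : Tendsto (fun u => ((k + 2 : ℝ) / (k + 1)) * c₁ * (F (θ * u) / F u) ^ 2 +
        (k + 2) * θ ^ (-α) * (2 * (k + 1) * (ρ u - r u) + r u)) atTop (nhds Q) :=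
      (((hF_rv θ hθ0).pow 2).const_mul _).add
        ((((hρ_lim.sub hsq).const_mul _).add hsq).const_mul _)
    have hQc : Q < (Q + c) / 2 := by linarith
    set ε : ℝ := (c - Q) / 2 / (((k + 2 : ℝ) / (k + 1)) * c₁ * C) with hε
    have hε0 : 0 < ε := by
      have : 0 < c - Q := by linarith
      positivity
    have hint' := (tendsto_id.const_mul_atTop hθ0).eventually hint
    have hev := ((hlim.eventually (gt_mem_nhds hQc)).and (hC.and hint')).and
      (eventually_gt_atTop 0)
    filter_upwards [hκ.eventually (eventually_forall_ge_atTop.2 hev), hbase 2 one_lt_two,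
      ih (by omega) hc₁', htail ε hε0, hA1.eventually (lt_mem_nhds hθ1), eventually_gt_atTop 0]
      with b h1 h2 h3 h4 h5 hb u hu
    obtain ⟨hA0, hAlt⟩ := hA01 b
    have hτ0 : 0 < 1 - A b := by linarith
    have hτ1 : 1 - A b ≤ 1 := by linarith
    have hu1 : b * (1 - A b) ^ (n - 1) ≤ u := by
      refine le_trans ?_ hu
      gcongr ?_ * ?_
      exact pow_le_pow_of_le_one hτ0.le hτ1 (by omega)
    have hu2 : b * (1 - A b) ^ (n - 2) ≤ u := by
      refine le_trans ?_ hu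
      gcongr ?_ * ?_
      exact pow_le_pow_of_le_one hτ0.le hτ1 (by omega)
    obtain ⟨⟨g1, g2, g3⟩, hu0⟩ := h1 u hu1
    simp only [id] at g3
    have hW1 : ∀ s, gpdSecondMoment α (A b) (b * (1 - A b) ^ (n - 1)) b f 1 s ≤ 2 := by
      refine gpdSecondMoment_one_le_two hf0 hf1 fun v hv => (h2 v hv).trans ?_
      have : 2 * F v ^ 2 ≤ 2 := by
        have := pow_le_one₀ (hF0 v).le (hF1 v) (n := 2)
        linarith
      simpa using ENNReal.ofReal_le_ofReal this
    have hWc : ∀ v, (1 - A b) * u ≤ v →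
        gpdSecondMoment α (A b) (b * (1 - A b) ^ (n - 1)) b f (k + 1) (b - v) ≤
          ENNReal.ofReal (c₁ * F v ^ 2) := by
      intro v hv
      refine h3 v (le_trans ?_ hv)
      have : n - 1 - k = (n - 1 - (k + 1)) + 1 := by omega
      rw [this, pow_succ]
      calc _ = (1 - A b) * (b * (1 - A b) ^ (n - 1 - (k + 1))) := by ring
        _ ≤ _ := by gcongr
    have hFu := hF0 u
    have key := gpdSecondMoment_step (M := 2 * ((k : ℝ) + 1)) (D := C * F u / u) hα hAlt hf hf0
      hf_supp hf1 hF (fun x => (hF0 x).le) (by positivity) hc₁0.le hu0 hθ0 h5.le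
      (gpdSecondMoment_le hα hA0.le hf hf0 hf1 hW1 k) hWc (by positivity) g2 g3
    refine key.trans (ENNReal.ofReal_le_ofReal ?_)
    have hk₁ : (0 : ℝ) < (k + 2 : ℝ) / (k + 1) := by positivity
    have m1 : ((k + 2 : ℝ) / (k + 1)) * c₁ * (C * F u / u * u * F ((1 - A b) * u) ^ 2) ≤
        (c - Q) / 2 * F u ^ 2 := by
      calc _ ≤ ((k + 2 : ℝ) / (k + 1)) * c₁ * (C * F u / u * u * (ε * F u)) := by
            gcongr
            exact h4 u hu2
        _ = _ := by
            rw [hε]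
            field_simp
    have m2 : ((k + 2 : ℝ) / (k + 1)) * c₁ * F (θ * u) ^ 2 + (k + 2) / α * (θ * u) ^ (-α) *
        (2 * (k + 1) * (R (θ * u) - R u) + R u) =
        (((k + 2 : ℝ) / (k + 1)) * c₁ * (F (θ * u) / F u) ^ 2 +
        (k + 2) * θ ^ (-α) * (2 * (k + 1) * (ρ u - r u) + r u)) * F u ^ 2 := by
      simp only [hρ, hr]
      rw [Real.mul_rpow hθ0.le hu0.le]
      field_simp
    have m3 := mul_le_mul_of_nonneg_right g1.le (sq_nonneg (F u))
    rw [← m2] at m3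
    calc _ = (((k + 2 : ℝ) / (k + 1)) * c₁ * F (θ * u) ^ 2 + (k + 2) / α * (θ * u) ^ (-α) *
        (2 * (k + 1) * (R (θ * u) - R u) + R u)) +
        ((k + 2 : ℝ) / (k + 1)) * c₁ * (C * F u / u * u * F ((1 - A b) * u) ^ 2) := by ring
      _ ≤ (Q + c) / 2 * F u ^ 2 + (c - Q) / 2 * F u ^ 2 := add_le_add m3 m1
      _ = c * F u ^ 2 := by ring

theorem tendsto_gpdSecondMoment_div {α : ℝ} (hα : 0 < α) {f F A : ℝ → ℝ} (hf : Measurable f)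
    (hf0 : ∀ x, 0 ≤ f x) (hf_supp : ∀ x ≤ (0 : ℝ), f x = 0)
    (hf1 : ∫⁻ x, ENNReal.ofReal (f x) = 1) (hF0 : ∀ u, 0 < F u) (hF1 : ∀ u, F u ≤ 1)
    (hF_lim : Tendsto F atTop (nhds 0))
    (hF_tail : ∀ b, ∫⁻ x in Ioi b, ENNReal.ofReal (f x) = ENNReal.ofReal (F b))
    {n : ℕ} (hn : 1 ≤ n) (hA01 : ∀ b, A b ∈ Ioo (0 : ℝ) 1)
    (hup : ∀ c, (n : ℝ) ^ 2 < c → ∀ᶠ b in atTop,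
      gpdSecondMoment α (A b) (b * (1 - A b) ^ (n - 1)) b f n 0 ≤ ENNReal.ofReal (c * F b ^ 2)) :
    Tendsto (fun b => (gpdSecondMoment α (A b) (b * (1 - A b) ^ (n - 1)) b f n 0).toReal /
      (tailProb b f n 0).toReal ^ 2) atTop (nhds 1) := by
  have hn0 : (0 : ℝ) < n := by exact_mod_cast hn
  set G : ℝ → ℝ := fun t => ∑ i ∈ Finset.range n, (1 - t) ^ i with hG
  have hGlim : Tendsto (fun b => G (F b)) atTop (nhds n) := tendsto_geom_sum_one_sub.comp hF_lim
  have hlow : ∀ b, F b * G (F b) ≤ (tailProb b f n 0).toReal := by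
    intro b
    have h1 := tailProb_ge hf hf_supp hf1 (hF0 b).le (hF1 b) (hF_tail b) n le_rfl
    have h2 : F b * G (F b) = 1 - (1 - F b) ^ n := by
      have := mul_neg_geom_sum (1 - F b) n
      rw [← this, hG]
      ring
    rw [h2]
    refine (ENNReal.ofReal_le_iff_le_toReal ?_).1 h1
    exact ((tailProb_le_one hf1 n 0).trans_lt ENNReal.one_lt_top).ne
  have hGpos : ∀ᶠ b in atTop, 0 < G (F b) := hGlim.eventually (lt_mem_nhds hn0)
  rw [tendsto_order]
  constructor
  · intro x hx
    filter_upwards [hup (n ^ 2 + 1) (by linarith), eventually_gt_atTop 0, hGpos] with b h1 hb h2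
    refine lt_of_lt_of_le hx ?_
    have hV : 0 < (tailProb b f n 0).toReal := (mul_pos (hF0 b) h2).trans_le (hlow b)
    rw [one_le_div (by positivity), ← ENNReal.toReal_pow]
    obtain ⟨hA0, hA1⟩ := hA01 b
    refine ENNReal.toReal_mono (h1.trans_lt ENNReal.ofReal_lt_top).ne
      (sq_tailProb_le_gpdSecondMoment hα hA0.le ?_ hf hf0 hf_supp hf1 n 0)
    have : 0 < 1 - A b := by linarith
    positivity
  · intro x hx
    set c := (n : ℝ) ^ 2 * ((1 + x) / 2) with hc
    have hcn : (n : ℝ) ^ 2 < c := lt_mul_of_one_lt_right (by positivity) (by linarith)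
    have hlim : Tendsto (fun b => c / G (F b) ^ 2) atTop (nhds (c / n ^ 2)) :=
      tendsto_const_nhds.div (hGlim.pow 2) (by positivity)
    have hcx : c / n ^ 2 < x := by
      rw [hc, mul_div_cancel_left₀ _ (by positivity)]
      linarith
    filter_upwards [hup c hcn, hGpos, hlim.eventually (gt_mem_nhds hcx)] with b h1 h2 h3
    have hFb := hF0 b
    have hV : 0 < F b * G (F b) := mul_pos hFb h2
    have h4 : (gpdSecondMoment α (A b) (b * (1 - A b) ^ (n - 1)) b f n 0).toReal ≤ c * F b ^ 2 :=
      ENNReal.toReal_le_of_le_ofReal (by positivity) h1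
    calc _ ≤ (c * F b ^ 2) / (F b * G (F b)) ^ 2 := by
          gcongr
          exact hlow b
      _ = c / G (F b) ^ 2 := by field_simp
      _ < x := h3

end Asymptotics

theorem setIntegral_prod_eq_toReal_iterInt {h : ℕ → ℝ → ℝ → ℝ}
    (hh : ∀ m, Measurable (Function.uncurry (h m))) (h0 : ∀ m s x, 0 ≤ h m s x) (n : ℕ) (b : ℝ) :
    ∫ x in {x : Fin n → ℝ | b < partialSum x n},
        ∏ i : Fin n, h (n - 1 - i) (partialSum x i) (x i) =
      (iterInt (fun m s x => ENNReal.ofReal (h m s x)) ((Ioi b).indicator 1) n 0).toReal := by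
  have hset : MeasurableSet {x : Fin n → ℝ | b < partialSum x n} :=
    measurableSet_lt measurable_const (measurable_partialSum n)
  have hmeas : Measurable fun x : Fin n → ℝ =>
      ∏ i : Fin n, h (n - 1 - i) (partialSum x i) (x i) :=
    Finset.measurable_prod _ fun i _ =>
      (hh _).comp ((measurable_partialSum i).prodMk (measurable_pi_apply i))
  rw [integral_eq_lintegral_of_nonneg_ae
      (Eventually.of_forall fun x => Finset.prod_nonneg fun i _ => h0 _ _ _)
      hmeas.aestronglyMeasurable,
    ← lintegral_pi_eq_iterInt (φ := fun m s x => ENNReal.ofReal (h m s x))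
      (fun m => (hh m).ennreal_ofReal)
      (measurable_one.indicator measurableSet_Ioi), ← lintegral_indicator hset]
  congr 1
  refine lintegral_congr fun x => ?_
  simp only [zero_add]
  by_cases hx : b < partialSum x n
  · rw [indicator_of_mem (by exact hx), indicator_of_mem (by exact hx),
      ENNReal.ofReal_prod_of_nonneg fun i _ => h0 _ _ _]
    simp
  · rw [indicator_of_notMem (by exact hx), indicator_of_notMem (by exact hx), zero_mul]

theorem exists_measurable_le_ae_eq_of_nonneg {f : ℝ → ℝ} (hf : AEMeasurable f volume)
    (hf0 : ∀ x, 0 ≤ f x) :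
    ∃ h : ℝ → ℝ, Measurable h ∧ (∀ x, 0 ≤ h x) ∧ (∀ x, h x ≤ f x) ∧ h =ᵐ[volume] f := by
  set N := toMeasurable volume {x | f x ≠ hf.mk f x} with hN
  have hN0 : volume N = 0 := by
    rw [hN, measure_toMeasurable]
    exact hf.ae_eq_mk
  have hmk : ∀ x ∉ N, hf.mk f x = f x := by
    intro x hx
    by_contra hne
    exact hx (subset_toMeasurable _ _ (Ne.symm hne))
  have hval : Nᶜ.indicator (hf.mk f) = Nᶜ.indicator f :=
    indicator_congr fun x hx => hmk x hx
  refine ⟨Nᶜ.indicator f, ?_, fun x => indicator_nonneg (fun y _ => hf0 y) x,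
    fun x => indicator_le_self' (fun y _ => hf0 y) x, ?_⟩
  · rw [← hval]
    exact hf.measurable_mk.indicator (measurableSet_toMeasurable _ _).compl
  · filter_upwards [compl_mem_ae_iff.2 hN0] with x hx
    exact indicator_of_mem hx f

theorem antitone_setIntegral_Ioi {f : ℝ → ℝ} (hf : Integrable f) (hf0 : ∀ x, 0 ≤ f x) :
    Antitone fun u => ∫ x in Ioi u, f x := fun _ _ huv =>
  setIntegral_mono_set hf.integrableOn (Eventually.of_forall hf0)
    (Ioi_subset_Ioi huv).eventuallyLE

theorem tendsto_setIntegral_Ioi_atTop {f : ℝ → ℝ} (hf : Integrable f) :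
    Tendsto (fun u => ∫ x in Ioi u, f x) atTop (nhds 0) := by
  have h := tendsto_setIntegral_of_antitone (μ := volume) (f := f) (s := fun u : ℝ => Ioi u)
    (fun _ => measurableSet_Ioi) (fun _ _ huv => Ioi_subset_Ioi huv) ⟨0, hf.integrableOn⟩
  have he : ⋂ u : ℝ, Ioi u = ∅ := by
    ext x
    simp only [mem_iInter, mem_Ioi, mem_empty_iff_false, iff_false, not_forall, not_lt]
    exact ⟨x, le_rfl⟩
  simpa [he] using h

theorem tendsto_one_of_order {A : ℝ → ℝ} (hA : ∀ b, A b ∈ Ioo (0 : ℝ) 1) {γ c : ℝ} (hγ : γ < 0)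
    (h : ∀ᶠ b in atTop, 1 - A b ≤ c * b ^ γ) : Tendsto A atTop (nhds 1) := by
  have h1 : Tendsto (fun b : ℝ => b ^ γ) atTop (nhds 0) := by
    simpa using tendsto_rpow_neg_atTop (neg_pos.2 hγ)
  have h2 : Tendsto (fun b => 1 - A b) atTop (nhds 0) :=
    tendsto_of_tendsto_of_tendsto_of_le_of_le' tendsto_const_nhds (by simpa using h1.const_mul c)
      (Eventually.of_forall fun b => by linarith [(hA b).2]) h
  simpa using h2.const_sub 1

/-- The generalized Pareto (GPD) mixture algorithm with p_i = (n-i)/(n-i+1) and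
1 - a_b of exact order b^(-1/(2(n-1))+δ) has asymptotically optimal
relative error: E p̂_b² / p_b² → 1. -/
theorem stmt_3
    (n : ℕ) (hn : 2 ≤ n) (α : ℝ) (hα : 0 < α)
    (f : ℝ → ℝ) (hf_nonneg : ∀ x, 0 ≤ f x)
    (hf_int : ∫ x, f x = 1)
    (hf_supp : ∀ x ≤ (0 : ℝ), f x = 0)
    (hf_rv : ∀ x : ℝ, 0 < x →
      Tendsto (fun u => f (u * x) / f u) atTop (nhds (x ^ (-α - 1))))
    (Fbar : ℝ → ℝ) (hFbar : ∀ b, Fbar b = ∫ t in Ioi b, f t)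
    (hFbar_pos : ∀ b, 0 < Fbar b)
    -- the level parameter a = a_b ∈ (0,1), with 1 - a_b of exact order
    -- b^(-1/(2(n-1)) + δ) for some 0 < δ < 1/(2(n-1))
    (δ : ℝ) (hδ : 0 < δ) (hδ' : δ < 1 / (2 * ((n : ℝ) - 1)))
    (a : ℝ → ℝ) (ha : ∀ b, a b ∈ Ioo (0 : ℝ) 1)
    (horder : ∃ c₁ > (0 : ℝ), ∃ c₂ : ℝ, ∀ᶠ b in atTop,
      c₁ * b ^ (-(1 / (2 * ((n : ℝ) - 1))) + δ) ≤ 1 - a b ∧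
      1 - a b ≤ c₂ * b ^ (-(1 / (2 * ((n : ℝ) - 1))) + δ))
    -- mixing probabilities p_i = (n-i)/(n-i+1)
    (p : ℕ → ℝ) (hp : ∀ i, 1 ≤ i → i < n → p i = ((n : ℝ) - i) / ((n : ℝ) - i + 1))
    -- generalized Pareto mixture densities
    (g : ℕ → ℝ → ℝ → ℝ → ℝ)
    (hg : ∀ i, 1 ≤ i → i < n → ∀ b s x, g i b s x =
      if a b * (b - s) < x then α * (a b * (b - s)) ^ α * x ^ (-α - 1) else 0)
    (hgn : ∀ b s x, g n b s x =
      if s ≤ b - b * (1 - a b) ^ (n - 1) then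
        (if b - s < x then α * (b - s) ^ α * x ^ (-α - 1) else 0)
      else f x)
    (ψ : ℕ → ℝ → ℝ → ℝ → ℝ)
    (hψ : ∀ i b s x, ψ i b s x =
      if b < s then f x
      else if i < n then p i * f x + (1 - p i) * g i b s x
      else g i b s x)
    (S : (Fin n → ℝ) → ℕ → ℝ)
    (hS : ∀ y k, S y k = ∑ j ∈ Finset.univ.filter (fun j : Fin n => (j : ℕ) < k), y j)
    (pb : ℝ → ℝ)
    (hpb : ∀ b, pb b = ∫ x in {x : Fin n → ℝ | b < S x n}, ∏ i : Fin n, f (x i))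
    (Ep2 : ℝ → ℝ)
    (hEp2 : ∀ b, Ep2 b = ∫ x in {x : Fin n → ℝ | b < S x n},
      ∏ i : Fin n, (f (x i)) ^ 2 / ψ ((i : ℕ) + 1) b (S x (i : ℕ)) (x i)) :
    Tendsto (fun b => Ep2 b / (pb b) ^ 2) atTop (nhds 1) := by
  obtain ⟨c₁, hc₁, c₂, horder⟩ := horder
  obtain rfl : Fbar = fun b => ∫ t in Ioi b, f t := funext hFbar
  have hf_i : Integrable f := integrable_of_integral_eq_one hf_int
  have hf_meas : AEMeasurable f volume := hf_i.aemeasurable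
  obtain ⟨h, hh, hh0, hhf, hhae⟩ := exists_measurable_le_ae_eq_of_nonneg hf_meas hf_nonneg
  have hh_supp : ∀ x ≤ (0 : ℝ), h x = 0 := fun x hx =>
    le_antisymm ((hhf x).trans_eq (hf_supp x hx)) (hh0 x)
  have hh_tail : ∀ b, ∫⁻ x in Ioi b, ENNReal.ofReal (h x) =
      ENNReal.ofReal (∫ t in Ioi b, f t) := by
    intro b
    rw [ofReal_integral_eq_lintegral_ofReal hf_i.integrableOn (Eventually.of_forall hf_nonneg)]
    refine lintegral_congr_ae (ae_restrict_of_ae ?_)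
    filter_upwards [hhae] with x hx using by rw [hx]
  have hh_one : ∫⁻ x, ENNReal.ofReal (h x) = 1 := by
    rw [← ENNReal.ofReal_one, ← hf_int,
      ofReal_integral_eq_lintegral_ofReal hf_i (Eventually.of_forall hf_nonneg)]
    refine lintegral_congr_ae ?_
    filter_upwards [hhae] with x hx using by rw [hx]
  have hsq_ae : (fun x => f x ^ 2 * x ^ (α + 1)) =ᵐ[volume] fun x => h x ^ 2 * x ^ (α + 1) := by
    filter_upwards [hhae] with x hx using by rw [hx]
  have hF_le_one : ∀ u, ∫ x in Ioi u, f x ≤ 1 := fun u =>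
    (setIntegral_le_integral hf_i (Eventually.of_forall hf_nonneg)).trans_eq hf_int
  have hF_rv : ∀ θ : ℝ, 0 < θ → Tendsto (fun u => (∫ x in Ioi (θ * u), f x) / ∫ x in Ioi u, f x)
      atTop (nhds (θ ^ (-α))) := fun θ hθ =>
    tail_regularly_varying hα hf_nonneg hf_meas hf_rv hθ
  have hF_anti := antitone_setIntegral_Ioi hf_i hf_nonneg
  have hτ01 : ∀ b, 1 - a b ∈ Ioo (0 : ℝ) 1 := fun b =>
    ⟨by linarith [(ha b).2], by linarith [(ha b).1]⟩
  have hτ := horder.mono fun b hb => hb.1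
  have hup : ∀ c, (n : ℝ) ^ 2 < c → ∀ᶠ b in atTop,
      gpdSecondMoment α (a b) (b * (1 - a b) ^ (n - 1)) b h n 0 ≤
        ENNReal.ofReal (c * (∫ x in Ioi b, f x) ^ 2) := by
    intro c hc
    have hn1 : n - 1 + 1 = n := by omega
    have key := eventually_gpdSecondMoment_le hα hh hh0 hh_supp hh_one hF_anti hFbar_pos hF_le_one
      hF_rv
      ((integrableOn_sq_mul_rpow hα hf_nonneg hf_meas hf_rv).mono fun u hu =>
        hu.congr_fun_ae (ae_restrict_of_ae hsq_ae))
      ((tendsto_second_moment_div hα hf_nonneg hf_meas hf_rv).congr fun u => by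
        rw [integral_congr_ae (ae_restrict_of_ae hsq_ae)])
      (fun η hη hη1 => by
        obtain ⟨C, hC, hC'⟩ := density_le_tail_div hα hf_nonneg hf_meas hf_rv hη hη1
        exact ⟨C, hC, hC'.mono fun u hu x hx => (hhf x).trans (hu x hx)⟩)
      ha (tendsto_one_of_order ha (by linarith) (horder.mono fun b hb => hb.2))
      (mul_pow_tendsto_atTop hn hδ hc₁ hτ)
      (fun ε hε => sq_tail_scaled_le hα hF_anti hFbar_pos hF_rv hn hδ hδ' hc₁ hτ01 hτ hε)
      (n - 1) (by omega) (c := c) (by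
        have : ((n - 1 : ℕ) : ℝ) + 1 = n := by exact_mod_cast hn1
        rwa [this])
    filter_upwards [key] with b hb
    simpa [hn1] using hb b (by simp)
  have hmain := tendsto_gpdSecondMoment_div hα hh hh0 hh_supp hh_one hFbar_pos hF_le_one
    (tendsto_setIntegral_Ioi_atTop hf_i) hh_tail (by omega) ha hup
  obtain rfl : S = fun y k => partialSum y k := by
    funext y k
    exact hS y k
  have hae : ∀ᵐ x : Fin n → ℝ, ∀ i, h (x i) = f (x i) :=
    ae_all_iff.2 fun i =>
      (Measure.tendsto_eval_ae_ae (μ := fun _ : Fin n => (volume : Measure ℝ)) (i := i)).eventually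
        hhae
  have hset : ∀ b, MeasurableSet {x : Fin n → ℝ | b < partialSum x n} := fun b =>
    measurableSet_lt measurable_const (measurable_partialSum n)
  refine hmain.congr fun b => ?_
  congr 1
  · rw [hEp2, gpdSecondMoment, ← setIntegral_prod_eq_toReal_iterInt
      (h := fun m s x => h x ^ 2 / gpdKernel α (a b) (b * (1 - a b) ^ (n - 1)) b h m s x)
      (fun m => by
        have := measurable_gpdKernel (α := α) (A := a b) (κ := b * (1 - a b) ^ (n - 1)) (b := b)
          hh m
        simp only [Function.uncurry_def] at this ⊢
        exact ((hh.comp measurable_snd).pow_const 2).div this)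
      (fun m s x => div_nonneg (sq_nonneg _) (gpdKernel_nonneg hα (ha b).1.le hh0 m s x))]
    refine setIntegral_congr_ae (hset b) ?_
    filter_upwards [hae] with x hx _
    refine Finset.prod_congr rfl fun i _ => ?_
    rw [hx i]
    congr 1
    rw [hψ]
    have hi := i.isLt
    by_cases hin : (i : ℕ) + 1 < n
    · obtain ⟨m, hm⟩ : ∃ m, n - 1 - i = m + 1 := ⟨n - 2 - i, by omega⟩
      have hnm : (n : ℝ) = i + m + 2 := by
        have : n = i + m + 2 := by omega
        exact_mod_cast this
      rw [hm]
      simp only [gpdKernel, paretoDensity, hx i, hp _ (by omega) hin, hg _ (by omega) hin, hin,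
        if_true]
      congr 1
      have hm0 : (0 : ℝ) < m + 2 := by positivity
      have e : ((n : ℝ) - ((i + 1 : ℕ) : ℝ)) / ((n : ℝ) - ((i + 1 : ℕ) : ℝ) + 1) =
          (m + 1) / (m + 2) := by
        rw [hnm]
        push_cast
        congr 1 <;> ring
      rw [e]
      field_simp
      ring
    · have hin' : (i : ℕ) + 1 = n := by omega
      have hm : n - 1 - (i : ℕ) = 0 := by omega
      rw [hm, hin', hgn]
      simp only [gpdKernel, paretoDensity, hx i, lt_irrefl, if_false]
  · congr 1
    rw [hpb, tailProb, ← setIntegral_prod_eq_toReal_iterInt (h := fun _ _ x => h x)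
      (fun m => hh.comp measurable_snd) (fun m s x => hh0 x)]
    refine setIntegral_congr_ae (hset b) ?_
    filter_upwards [hae] with x hx _
    exact Finset.prod_congr rfl fun i _ => hx i
end

section
/- Let X_1,…,X_n be i.i.d. nonnegative random variables with density f whose right tail is regularly varying with index −α−1 for some α > 0, and for b > 0 define the finite measure m_b on ℝ^n by m_b(A) = P( (X_1/b, …, X_n/b) ∈ A and X_1+⋯+X_n > b ) / F̄(b). Then m_b converges weakly as b → ∞ to the measure m given by m(A) = Σ_{i=1}^n ∫_1^∞ 1{ y·e_i ∈ A } α y^{−α−1} dy, where e_i is the i-th standard basis vector of ℝ^n; that is, for every bounded continuous function h : ℝ^n → ℝ, ∫ h dm_b → Σ_{i=1}^n ∫_1^∞ h(y·e_i) α y^{−α−1} dy. -/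
open MeasureTheory Filter Set Real
open ProbabilityTheory

theorem tendsto_tail_ratio_of_density_ratio {f : ℝ → ℝ} (hf_nonneg : ∀ x, 0 ≤ f x)
    (hf : Integrable f) {α : ℝ}
    (hf_rv : ∀ x : ℝ, 0 < x →
      Tendsto (fun u => f (u * x) / f u) atTop (nhds (x ^ (-α - 1))))
    (hpos : ∀ b, 0 < ∫ t in Ioi b, f t) {x : ℝ} (hx : 0 < x) :
    Tendsto (fun b => (∫ t in Ioi (b * x), f t) / ∫ t in Ioi b, f t) atTop
      (nhds (x ^ (-α))) := by
  have hf_ne : ∀ᶠ u in atTop, f u ≠ 0 := by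
    have h1 := hf_rv 1 one_pos
    simp only [mul_one, one_rpow] at h1
    filter_upwards [h1.eventually_ne one_ne_zero] with u hu h0
    simp [h0] at hu
  rw [Metric.tendsto_atTop]
  intro ε hε
  set L := x ^ (-α - 1) with hL
  have hxL : x ^ (-α) = x * L := by
    rw [hL, rpow_sub_one hx.ne', mul_div_cancel₀ _ hx.ne']
  obtain ⟨T, hT⟩ := eventually_atTop.1 (hf_ne.and
    ((Metric.tendsto_nhds.1 (hf_rv x hx)) (ε / (2 * x)) (by positivity)))
  refine ⟨T, fun b hb => ?_⟩
  have hsub : ∫ t in Ioi (b * x), f t = x * ∫ t in Ioi b, f (x * t) := by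
    rw [integral_comp_mul_left_Ioi f b hx, smul_eq_mul, mul_comm x b,
      mul_inv_cancel_left₀ hx.ne']
  have hfx : Integrable (fun t => f (x * t)) := hf.comp_mul_left' hx.ne'
  have hbound : |∫ t in Ioi b, (f (x * t) - L * f t)| ≤ ∫ t in Ioi b, ε / (2 * x) * f t := by
    rw [← Real.norm_eq_abs]
    refine norm_integral_le_of_norm_le (hf.const_mul _).integrableOn ?_
    refine ae_restrict_of_forall_mem measurableSet_Ioi fun t ht => ?_
    obtain ⟨h0, h1⟩ := hT t (hb.trans (le_of_lt ht))
    have hft : 0 < f t := lt_of_le_of_ne (hf_nonneg t) h0.symm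
    rw [Real.dist_eq] at h1
    rw [Real.norm_eq_abs, show f (x * t) - L * f t = (f (t * x) / f t - L) * f t by
      rw [mul_comm x t]; field_simp, abs_mul, abs_of_pos hft]
    gcongr
  rw [integral_sub hfx.integrableOn (hf.const_mul _).integrableOn, integral_const_mul,
    integral_const_mul] at hbound
  have hG := hpos b
  rw [Real.dist_eq, hxL, hsub,
    show ∀ I G : ℝ, G ≠ 0 → x * I / G - x * L = x * ((I - L * G) / G) by
      intro I G hG; field_simp, abs_mul, abs_div, abs_of_pos hx, abs_of_pos hG]
  · calc x * (|(∫ t in Ioi b, f (x * t)) - L * ∫ t in Ioi b, f t| / ∫ t in Ioi b, f t)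
        ≤ x * ((ε / (2 * x) * ∫ t in Ioi b, f t) / ∫ t in Ioi b, f t) := by gcongr
      _ = ε / 2 := by field_simp
      _ < ε := half_lt_self hε
  · exact hG.ne'

theorem integral_paretoMeasure_one {α : ℝ} (hα : 0 < α) (g : ℝ → ℝ) :
    ∫ y, g y ∂(paretoMeasure 1 α) = ∫ y in Ioi (1 : ℝ), g y * (α * y ^ (-α - 1)) := by
  have hmeas : Measurable (paretoPDF 1 α) := by unfold paretoPDF; fun_prop
  rw [paretoMeasure, integral_withDensity_eq_integral_toReal_smul hmeas
      (ae_of_all _ fun _ => ENNReal.ofReal_lt_top),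
    ← integral_Ici_eq_integral_Ioi, ← integral_indicator measurableSet_Ici]
  congr 1 with y
  by_cases hy : 1 ≤ y
  · have : 0 ≤ y ^ (-α - 1) := rpow_nonneg (by linarith) _
    rw [indicator_of_mem (mem_Ici.2 hy), paretoPDF_of_le hy, one_rpow, mul_one, neg_add',
      ENNReal.toReal_ofReal (by positivity), smul_eq_mul, mul_comm]
  · rw [indicator_of_notMem (by simpa using hy), paretoPDF_of_lt (not_le.1 hy)]
    simp

theorem paretoMeasure_one_real_Ioi {α : ℝ} (hα : 0 < α) (y : ℝ) :
    (paretoMeasure 1 α).real (Ioi y) = (max 1 y) ^ (-α) := by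
  have h1 : (0 : ℝ) < max 1 y := lt_max_of_lt_left one_pos
  rw [← integral_indicator_one measurableSet_Ioi, integral_paretoMeasure_one hα,
    ← integral_indicator measurableSet_Ioi]
  have : (Ioi (1 : ℝ)).indicator (fun t => (Ioi y).indicator 1 t * (α * t ^ (-α - 1))) =
      (Ioi (max 1 y)).indicator (fun t => α * t ^ (-α - 1)) := by
    ext t
    by_cases h1 : 1 < t <;> by_cases h2 : y < t <;> simp [indicator, h1, h2]
  rw [this, integral_indicator measurableSet_Ioi, integral_const_mul,
    integral_Ioi_rpow_of_lt (by linarith) h1]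
  rw [sub_add_cancel]
  field_simp

theorem withDensity_prod_eq_pi {n : ℕ} {f : ℝ → ℝ} (hf_nonneg : ∀ x, 0 ≤ f x)
    (hf : Integrable f) :
    (volume : Measure (Fin n → ℝ)).withDensity (fun x => ENNReal.ofReal (∏ i, f (x i))) =
      Measure.pi fun _ => volume.withDensity fun t => ENNReal.ofReal (f t) := by
  have : IsFiniteMeasure (volume.withDensity fun t => ENNReal.ofReal (f t)) :=
    isFiniteMeasure_withDensity_ofReal hf.2
  refine (Measure.pi_eq fun s hs => ?_).symm
  rw [withDensity_apply _ (MeasurableSet.univ_pi hs),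
    ← ofReal_integral_eq_lintegral_ofReal
      (volume_pi (α := fun _ : Fin n => ℝ) ▸ Integrable.fintype_prod fun _ => hf).integrableOn
      (ae_of_all _ fun x => Finset.prod_nonneg fun i _ => hf_nonneg _),
    volume_pi, Measure.restrict_pi_pi, integral_fintype_prod_eq_prod,
    ENNReal.ofReal_prod_of_nonneg fun i _ => integral_nonneg hf_nonneg]
  refine Finset.prod_congr rfl fun i _ => ?_
  rw [withDensity_apply _ (hs i), ofReal_integral_eq_lintegral_ofReal hf.integrableOn
    (ae_of_all _ hf_nonneg)]

theorem tendsto_measureReal_Ioi_atTop (μ : Measure ℝ) [IsFiniteMeasure μ] :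
    Tendsto (fun b => μ.real (Ioi b)) atTop (nhds 0) := by
  have h := tendsto_measure_iInter_atTop (μ := μ) (s := fun b : ℝ => Ioi b)
    (fun b => measurableSet_Ioi.nullMeasurableSet) (fun a b hab => Ioi_subset_Ioi hab)
    ⟨0, measure_ne_top _ _⟩
  have he : ⋂ b : ℝ, Ioi b = ∅ := by
    ext x
    simp only [mem_iInter, mem_Ioi, mem_empty_iff_false, iff_false, not_forall, not_lt]
    exact ⟨x, le_rfl⟩
  rw [he, measure_empty] at h
  exact (ENNReal.tendsto_toReal ENNReal.zero_ne_top).comp h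

theorem tendsto_cond_map_div_paretoMeasure {μ : Measure ℝ} [IsProbabilityMeasure μ] {α : ℝ}
    (hα : 0 < α)
    (hrv : ∀ x : ℝ, 0 < x →
      Tendsto (fun b => μ.real (Ioi (b * x)) / μ.real (Ioi b)) atTop (nhds (x ^ (-α))))
    {ν : ℝ → ProbabilityMeasure ℝ}
    (hν : ∀ b, (ν b : Measure ℝ) = (μ[|Ioi b]).map (· / b))
    {ρ : ProbabilityMeasure ℝ} (hρ : (ρ : Measure ℝ) = paretoMeasure 1 α) :
    Tendsto ν atTop (nhds ρ) := by
  have hIoi (y : ℝ) : Tendsto (fun b => (ν b : Measure ℝ).real (Ioi y)) atTop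
      (nhds ((ρ : Measure ℝ).real (Ioi y))) := by
    rw [hρ, paretoMeasure_one_real_Ioi hα]
    refine (hrv (max 1 y) (lt_max_of_lt_left one_pos)).congr' ?_
    filter_upwards [eventually_gt_atTop 0] with b hb
    rw [hν, map_measureReal_apply (by fun_prop) measurableSet_Ioi,
      measureReal_def (μ[|Ioi b]), cond_apply measurableSet_Ioi, ENNReal.toReal_mul,
      ENNReal.toReal_inv, ← measureReal_def, ← measureReal_def, div_eq_inv_mul]
    congr 2
    ext t
    simp only [mem_Ioi, mem_inter_iff, mem_preimage, lt_div_iff₀ hb]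
    rw [mul_max_of_nonneg _ _ hb.le, mul_one, max_lt_iff, mul_comm]
  refine (isPiSystem_Ioc (id : ℝ → ℝ) id).tendsto_probabilityMeasure_of_tendsto_of_mem ?_ ?_ ?_
  · rintro _ ⟨a, c, -, rfl⟩
    exact measurableSet_Ioc
  · intro u hu x hx
    obtain ⟨ε, hε, hsub⟩ := Metric.isOpen_iff.1 hu x hx
    refine ⟨Ioc (x - ε / 2) (x + ε / 2), ⟨_, _, by simp; linarith, rfl⟩,
      Ioc_mem_nhds (by linarith) (by linarith), fun z hz => hsub ?_⟩
    rw [Metric.mem_ball, Real.dist_eq, abs_lt]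
    constructor <;> linarith [hz.1, hz.2]
  · rintro _ ⟨a, c, hac, rfl⟩
    simp only [id] at hac ⊢
    rw [← NNReal.tendsto_coe]
    have key (κ : ProbabilityMeasure ℝ) : ((κ (Ioc a c) : NNReal) : ℝ) =
        (κ : Measure ℝ).real (Ioi a) - (κ : Measure ℝ).real (Ioi c) := by
      rw [← measureReal_sdiff (Ioi_subset_Ioi hac.le) measurableSet_Ioi, Ioi_sdiff_Ioi]
      rfl
    simp_rw [key]
    exact (hIoi a).sub (hIoi c)

theorem tendsto_map_div_dirac {μ : Measure ℝ} [IsProbabilityMeasure μ]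
    {ν : ℝ → ProbabilityMeasure ℝ} (hν : ∀ b, (ν b : Measure ℝ) = μ.map (· / b))
    {ρ : ProbabilityMeasure ℝ} (hρ : (ρ : Measure ℝ) = Measure.dirac 0) :
    Tendsto ν atTop (nhds ρ) := by
  rw [ProbabilityMeasure.tendsto_iff_forall_integral_tendsto]
  intro g
  simp_rw [hν, hρ, integral_dirac]
  simp_rw [fun b => integral_map (μ := μ) (φ := (· / b)) (by fun_prop)
    (g.continuous.aestronglyMeasurable)]
  have : g 0 = ∫ _, g 0 ∂μ := by simp
  rw [this]
  refine tendsto_integral_filter_of_dominated_convergence (fun _ => ‖g‖)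
    (Eventually.of_forall fun b => by fun_prop)
    (Eventually.of_forall fun b => ae_of_all _ fun x => g.norm_coe_le_norm _)
    (integrable_const _) (ae_of_all _ fun x => ?_)
  exact (g.continuous.tendsto 0).comp (tendsto_const_nhds.div_atTop tendsto_id)

theorem pi_dirac_eq_map {ι : Type*} [Fintype ι] [DecidableEq ι] (i : ι) (ν : Measure ℝ)
    [SigmaFinite ν] :
    (Measure.pi fun j => if j = i then ν else Measure.dirac 0) =
      ν.map fun y j => if j = i then y else 0 := by
  have (j : ι) : SigmaFinite (if j = i then ν else Measure.dirac (0 : ℝ)) := by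
    split_ifs <;> infer_instance
  refine Measure.pi_eq fun s hs => ?_
  have hm : Measurable fun (y : ℝ) (j : ι) => if j = i then y else 0 := by
    refine measurable_pi_lambda _ fun j => ?_
    split_ifs <;> fun_prop
  rw [Measure.map_apply hm (MeasurableSet.univ_pi hs), Fintype.prod_eq_mul_prod_compl i, if_pos rfl]
  by_cases h : ∀ j ≠ i, (0 : ℝ) ∈ s j
  · rw [Finset.prod_eq_one, mul_one]
    · congr 1
      ext y
      simp only [mem_preimage, mem_univ_pi]
      refine ⟨fun hy => by simpa using hy i, fun hy j => ?_⟩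
      by_cases hj : j = i
      · subst hj; simpa using hy
      · simpa [hj] using h j hj
    · intro j hj
      have hj : j ≠ i := by simpa using hj
      simp [hj, hs j, h j hj]
  · push Not at h
    obtain ⟨j, hj, hj0⟩ := h
    rw [Finset.prod_eq_zero (i := j) (by simpa using hj) (by simp [hj, hs j, hj0]), mul_zero]
    convert! measure_empty (μ := ν)
    ext y
    simp only [mem_preimage, mem_univ_pi, mem_empty_iff_false, iff_false, not_forall]
    exact ⟨j, by simpa [hj] using hj0⟩

theorem pi_cond_eq_cond_pi {ι : Type*} [Fintype ι] [DecidableEq ι] (i : ι) (μ : Measure ℝ)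
    [IsProbabilityMeasure μ] {t : Set ℝ} (ht : MeasurableSet t) :
    (Measure.pi fun j => if j = i then μ[|t] else μ) =
      (Measure.pi fun _ : ι => μ)[|{x | x i ∈ t}] := by
  have (j : ι) : SigmaFinite (if j = i then μ[|t] else μ) := by
    split_ifs <;> infer_instance
  refine Measure.pi_eq fun s hs => ?_
  have hm : MeasurableSet {x : ι → ℝ | x i ∈ t} := measurable_pi_apply i ht
  have hset : {x : ι → ℝ | x i ∈ t} ∩ univ.pi s =
      univ.pi fun j => if j = i then t ∩ s j else s j := by
    ext x
    simp only [mem_inter_iff, mem_ofPred_eq, mem_univ_pi]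
    refine ⟨fun ⟨h1, h2⟩ j => ?_, fun h => ⟨?_, fun j => ?_⟩⟩
    · split_ifs with hj
      · subst hj; exact ⟨h1, h2 _⟩
      · exact h2 j
    · have := h i; rw [if_pos rfl] at this; exact this.1
    · have := h j; split_ifs at this with hj
      · exact this.2
      · exact this
  have hmarg : Measure.pi (fun _ : ι => μ) {x | x i ∈ t} = μ t :=
    (measurePreserving_eval (fun _ : ι => μ) i).measure_preimage ht.nullMeasurableSet
  rw [cond_apply hm, hset, hmarg, Measure.pi_pi, Fintype.prod_eq_mul_prod_compl i,
    Fintype.prod_eq_mul_prod_compl i, if_pos rfl, if_pos rfl, cond_apply ht, mul_assoc]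
  congr 2
  refine Finset.prod_congr rfl fun j hj => ?_
  have hj : j ≠ i := by simpa using hj
  simp [hj]

theorem pi_measureReal_eval_preimage {ι : Type*} [Fintype ι] (i : ι) (μ : Measure ℝ)
    [IsProbabilityMeasure μ] {t : Set ℝ} (ht : MeasurableSet t) :
    (Measure.pi fun _ : ι => μ).real {x | x i ∈ t} = μ.real t :=
  congrArg ENNReal.toReal
    ((measurePreserving_eval (fun _ : ι => μ) i).measure_preimage ht.nullMeasurableSet)

theorem tendsto_setIntegral_single_exceedance {ι : Type*} [Fintype ι] [DecidableEq ι]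
    {μ : Measure ℝ} [IsProbabilityMeasure μ] {α : ℝ}
    (hα : 0 < α) (hpos : ∀ b, 0 < μ.real (Ioi b))
    (hrv : ∀ x : ℝ, 0 < x →
      Tendsto (fun b => μ.real (Ioi (b * x)) / μ.real (Ioi b)) atTop (nhds (x ^ (-α))))
    {h : (ι → ℝ) → ℝ} (hh : Continuous h) {M : ℝ} (hM : ∀ x, |h x| ≤ M) (i : ι) :
    Tendsto (fun b => (∫ x in {x | b < x i}, h (fun j => x j / b)
        ∂(Measure.pi fun _ => μ)) / μ.real (Ioi b)) atTop
      (nhds (∫ y in Ioi (1 : ℝ), h (fun j => if j = i then y else 0) * (α * y ^ (-α - 1)))) := by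
  have hcond (b : ℝ) : IsProbabilityMeasure (μ[|Ioi b]) :=
    cond_isProbabilityMeasure fun h0 => (hpos b).ne' (by simp [measureReal_def, h0])
  have hpar := isProbabilityMeasure_paretoMeasure one_pos hα
  let ν (b : ℝ) : ProbabilityMeasure ℝ :=
    ⟨(μ[|Ioi b]).map (· / b), Measure.isProbabilityMeasure_map (by fun_prop)⟩
  let σ (b : ℝ) : ProbabilityMeasure ℝ :=
    ⟨μ.map (· / b), Measure.isProbabilityMeasure_map (by fun_prop)⟩
  let ρ : ProbabilityMeasure ℝ := ⟨paretoMeasure 1 α, hpar⟩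
  let δ : ProbabilityMeasure ℝ := ⟨Measure.dirac 0, inferInstance⟩
  have hν : Tendsto ν atTop (nhds ρ) :=
    tendsto_cond_map_div_paretoMeasure hα hrv (fun _ => rfl) rfl
  have hσ : Tendsto σ atTop (nhds δ) := tendsto_map_div_dirac (fun _ => rfl) rfl
  have hfam : Tendsto (fun b j => if j = i then ν b else σ b) atTop
      (nhds fun j => if j = i then ρ else δ) := by
    rw [tendsto_pi_nhds]
    intro j
    by_cases hj : j = i
    · simpa [hj] using hν
    · simpa [hj] using hσ
  have hpi := (ProbabilityMeasure.continuous_pi.tendsto _).comp hfam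
  rw [ProbabilityMeasure.tendsto_iff_forall_integral_tendsto] at hpi
  have key := hpi (BoundedContinuousFunction.ofNormedAddCommGroup h hh M hM)
  simp only [BoundedContinuousFunction.coe_ofNormedAddCommGroup, Function.comp_apply,
    ProbabilityMeasure.toMeasure_pi] at key
  have hemb : Measurable fun (y : ℝ) (j : ι) => if j = i then y else 0 := by
    refine measurable_pi_lambda _ fun j => ?_
    split_ifs <;> fun_prop
  have hlim : (fun j => ((if j = i then ρ else δ : ProbabilityMeasure ℝ) : Measure ℝ)) =
      fun j => if j = i then paretoMeasure 1 α else Measure.dirac 0 := by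
    ext1 j
    split_ifs <;> rfl
  rw [hlim, pi_dirac_eq_map, integral_map hemb.aemeasurable hh.aestronglyMeasurable,
    integral_paretoMeasure_one hα] at key
  refine key.congr fun b => ?_
  have hinst (j : ι) : IsProbabilityMeasure (if j = i then μ[|Ioi b] else μ) := by
    split_ifs <;> infer_instance
  have hmaps : (fun j => ((if j = i then ν b else σ b : ProbabilityMeasure ℝ) : Measure ℝ)) =
      fun j => (if j = i then μ[|Ioi b] else μ).map (· / b) := by
    ext1 j
    split_ifs <;> rfl
  have hpres (j : ι) : IsProbabilityMeasure ((if j = i then μ[|Ioi b] else μ).map (· / b)) :=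
    Measure.isProbabilityMeasure_map (by fun_prop)
  have hdiv : Measurable fun (x : ι → ℝ) (j : ι) => x j / b := by fun_prop
  rw [hmaps, ← Measure.pi_map_pi (fun j => by fun_prop), pi_cond_eq_cond_pi i μ measurableSet_Ioi,
    integral_map hdiv.aemeasurable hh.aestronglyMeasurable, ProbabilityTheory.cond, integral_smul_measure,
    ENNReal.toReal_inv, ← measureReal_def, pi_measureReal_eval_preimage i μ measurableSet_Ioi,
    smul_eq_mul, div_eq_inv_mul]
  rfl

theorem abs_indicator_sum_sub_sum_indicator_le {n : ℕ} (hn : 1 ≤ n) {b δ : ℝ} (hb : 0 < b)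
    (hδ0 : 0 < δ) (hδ : δ ≤ 1 / 2) {x : Fin n → ℝ} (hx : ∀ i, 0 ≤ x i) :
    |{x : Fin n → ℝ | b < ∑ i, x i}.indicator (fun _ => (1 : ℝ)) x -
        ∑ i, {x : Fin n → ℝ | b < x i}.indicator (fun _ => (1 : ℝ)) x| ≤
      ∑ i, {x : Fin n → ℝ | x i ∈ Ioc (b * (1 - δ)) b}.indicator (fun _ => (1 : ℝ)) x +
        n * ∑ i, ∑ j ∈ Finset.univ.erase i,
          {x : Fin n → ℝ | b * (δ / n) < x i ∧ b * (δ / n) < x j}.indicator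
            (fun _ => (1 : ℝ)) x := by
  have hn' : (1 : ℝ) ≤ n := by exact_mod_cast hn
  have hsum_nonneg : 0 ≤ ∑ i, {x : Fin n → ℝ | x i ∈ Ioc (b * (1 - δ)) b}.indicator
      (fun _ => (1 : ℝ)) x :=
    Finset.sum_nonneg fun i _ => indicator_nonneg (fun _ _ => zero_le_one) _
  have hpair_nonneg (i j : Fin n) : 0 ≤ {x : Fin n → ℝ | b * (δ / n) < x i ∧
      b * (δ / n) < x j}.indicator (fun _ => (1 : ℝ)) x :=
    indicator_nonneg (fun _ _ => zero_le_one) _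
  by_cases hE : ∃ i j, i ≠ j ∧ b * (δ / n) < x i ∧ b * (δ / n) < x j
  · obtain ⟨i, j, hij, hxi, hxj⟩ := hE
    have hmem : x ∈ {x : Fin n → ℝ | b * (δ / n) < x i ∧ b * (δ / n) < x j} := ⟨hxi, hxj⟩
    have h1 : 1 ≤ ∑ i, ∑ j ∈ Finset.univ.erase i, {x : Fin n → ℝ | b * (δ / n) < x i ∧
        b * (δ / n) < x j}.indicator (fun _ => (1 : ℝ)) x := by
      calc (1 : ℝ) = {x : Fin n → ℝ | b * (δ / n) < x i ∧ b * (δ / n) < x j}.indicator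
            (fun _ => (1 : ℝ)) x := by rw [indicator_of_mem hmem]
        _ ≤ ∑ j ∈ Finset.univ.erase i, {x : Fin n → ℝ | b * (δ / n) < x i ∧
              b * (δ / n) < x j}.indicator (fun _ => (1 : ℝ)) x :=
          Finset.single_le_sum (f := fun j => {x : Fin n → ℝ | b * (δ / n) < x i ∧
              b * (δ / n) < x j}.indicator (fun _ => (1 : ℝ)) x)
            (fun j _ => hpair_nonneg i j) (by simpa using hij.symm)
        _ ≤ _ := Finset.single_le_sum (f := fun i => ∑ j ∈ Finset.univ.erase i,
              {x : Fin n → ℝ | b * (δ / n) < x i ∧ b * (δ / n) < x j}.indicator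
                (fun _ => (1 : ℝ)) x)
            (fun i _ => Finset.sum_nonneg fun j _ => hpair_nonneg i j) (Finset.mem_univ i)
    have hA : {x : Fin n → ℝ | b < ∑ i, x i}.indicator (fun _ => (1 : ℝ)) x ∈ Icc (0 : ℝ) 1 :=
      ⟨indicator_nonneg (fun _ _ => zero_le_one) _, indicator_le_self' (fun _ _ => zero_le_one) _⟩
    have hB0 : 0 ≤ ∑ i, {x : Fin n → ℝ | b < x i}.indicator (fun _ => (1 : ℝ)) x :=
      Finset.sum_nonneg fun i _ => indicator_nonneg (fun _ _ => zero_le_one) _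
    have hB1 : ∑ i, {x : Fin n → ℝ | b < x i}.indicator (fun _ => (1 : ℝ)) x ≤ n := by
      calc _ ≤ ∑ _i : Fin n, (1 : ℝ) :=
            Finset.sum_le_sum fun i _ => indicator_le_self' (fun _ _ => zero_le_one) _
        _ = n := by simp
    have : (n : ℝ) ≤ n * ∑ i, ∑ j ∈ Finset.univ.erase i, {x : Fin n → ℝ | b * (δ / n) < x i ∧
        b * (δ / n) < x j}.indicator (fun _ => (1 : ℝ)) x :=
      le_mul_of_one_le_right (by linarith) h1
    rw [abs_le]
    constructor <;> linarith [hA.1, hA.2]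
  · push Not at hE
    obtain ⟨k, hk⟩ : ∃ k, ∀ j ≠ k, x j ≤ b * (δ / n) := by
      by_cases hk : ∃ k, b * (δ / n) < x k
      · obtain ⟨k, hk⟩ := hk
        exact ⟨k, fun j hj => hE k j hj.symm hk⟩
      · push Not at hk
        exact ⟨⟨0, hn⟩, fun j _ => hk j⟩
    have hcb : b * (δ / n) ≤ b * δ := by
      gcongr
      exact div_le_self hδ0.le hn'
    have hbδ : b * δ ≤ b * (1 / 2) := by gcongr
    have hB : ∑ i, {x : Fin n → ℝ | b < x i}.indicator (fun _ => (1 : ℝ)) x =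
        {x : Fin n → ℝ | b < x k}.indicator (fun _ => (1 : ℝ)) x := by
      refine Finset.sum_eq_single k (fun j _ hj => indicator_of_notMem ?_ _) (by simp)
      have := hk j hj
      simp only [mem_ofPred_eq, not_lt]
      linarith
    have hC : {x : Fin n → ℝ | x k ∈ Ioc (b * (1 - δ)) b}.indicator (fun _ => (1 : ℝ)) x ≤
        ∑ i, {x : Fin n → ℝ | x i ∈ Ioc (b * (1 - δ)) b}.indicator (fun _ => (1 : ℝ)) x :=
      Finset.single_le_sum (f := fun i => {x : Fin n → ℝ | x i ∈ Ioc (b * (1 - δ)) b}.indicator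
        (fun _ => (1 : ℝ)) x) (fun i _ => indicator_nonneg (fun _ _ => zero_le_one) _)
        (Finset.mem_univ k)
    have hrest : 0 ≤ n * ∑ i, ∑ j ∈ Finset.univ.erase i, {x : Fin n → ℝ | b * (δ / n) < x i ∧
        b * (δ / n) < x j}.indicator (fun _ => (1 : ℝ)) x :=
      mul_nonneg (by linarith)
        (Finset.sum_nonneg fun i _ => Finset.sum_nonneg fun j _ => hpair_nonneg i j)
    refine le_trans ?_ (le_add_of_le_of_nonneg hC hrest)
    have hle : x k ≤ ∑ i, x i := Finset.single_le_sum (fun i _ => hx i) (Finset.mem_univ k)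
    have hge : ∑ i, x i ≤ x k + b * δ := by
      rw [Fintype.sum_eq_add_sum_compl k]
      gcongr
      calc ∑ i ∈ {k}ᶜ, x i ≤ ∑ i ∈ ({k} : Finset (Fin n))ᶜ, b * (δ / n) :=
            Finset.sum_le_sum fun i hi => hk i (by simpa using hi)
        _ ≤ ∑ _i : Fin n, b * (δ / n) :=
            Finset.sum_le_univ_sum_of_nonneg fun _ => by positivity
        _ = b * δ := by simp; field_simp
    rw [hB]
    by_cases h1 : b < x k
    · simp [indicator, h1, h1.trans_le hle, not_le.2 h1]
    · by_cases h2 : b < ∑ i, x i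
      · have h3 : b * (1 - δ) < x k := by linarith
        simp [indicator, h1, h2, h3, not_lt.1 h1]
      · simp only [indicator, mem_ofPred_eq, h1, h2, if_false]
        split_ifs <;> simp

theorem pi_measureReal_two_eval_preimage {ι : Type*} [Fintype ι] {i j : ι} (hij : i ≠ j)
    (μ : Measure ℝ) [IsProbabilityMeasure μ] (t : Set ℝ) :
    (Measure.pi fun _ : ι => μ).real {x | x i ∈ t ∧ x j ∈ t} = μ.real t ^ 2 := by
  classical
  have hset : {x : ι → ℝ | x i ∈ t ∧ x j ∈ t} =
      univ.pi fun k => if k = i ∨ k = j then t else univ := by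
    ext x
    simp only [mem_ofPred_eq, mem_univ_pi]
    refine ⟨fun ⟨h1, h2⟩ k => ?_, fun h => ⟨by simpa using h i, by simpa using h j⟩⟩
    split_ifs with hk
    · rcases hk with rfl | rfl <;> assumption
    · trivial
  rw [hset, measureReal_def, Measure.pi_pi, Fintype.prod_eq_mul i j hij, if_pos (Or.inl rfl),
    if_pos (Or.inr rfl), ← sq, ENNReal.toReal_pow, measureReal_def]
  rintro k ⟨hki, hkj⟩
  simp [hki, hkj]

theorem abs_setIntegral_sum_sub_sum_setIntegral_le {n : ℕ} (hn : 1 ≤ n) {μ : Measure ℝ}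
    [IsProbabilityMeasure μ] (hμ : ∀ᵐ t ∂μ, 0 ≤ t) {b δ : ℝ} (hb : 0 < b)
    (hδ0 : 0 < δ) (hδ : δ ≤ 1 / 2) {g : (Fin n → ℝ) → ℝ} (hg : Continuous g) {M : ℝ}
    (hM : ∀ x, |g x| ≤ M) :
    |(∫ x in {x | b < ∑ i, x i}, g x ∂(Measure.pi fun _ => μ)) -
        ∑ i, ∫ x in {x | b < x i}, g x ∂(Measure.pi fun _ => μ)| ≤
      M * (n * (μ.real (Ioi (b * (1 - δ))) - μ.real (Ioi b)) +
        n ^ 3 * μ.real (Ioi (b * (δ / n))) ^ 2) := by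
  set P : Measure (Fin n → ℝ) := Measure.pi fun _ => μ with hP
  have hM0 : 0 ≤ M := (abs_nonneg _).trans (hM 0)
  have hmA : MeasurableSet {x : Fin n → ℝ | b < ∑ i, x i} :=
    measurableSet_lt measurable_const (by fun_prop)
  have hmB (i : Fin n) : MeasurableSet {x : Fin n → ℝ | b < x i} :=
    measurableSet_lt measurable_const (by fun_prop)
  have hmC (i : Fin n) : MeasurableSet {x : Fin n → ℝ | x i ∈ Ioc (b * (1 - δ)) b} :=
    measurable_pi_apply i measurableSet_Ioc
  have hmE (i j : Fin n) :
      MeasurableSet {x : Fin n → ℝ | b * (δ / n) < x i ∧ b * (δ / n) < x j} :=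
    (measurable_pi_apply i measurableSet_Ioi).inter (measurable_pi_apply j measurableSet_Ioi)
  have hg_int : Integrable g P :=
    Integrable.of_bound hg.aestronglyMeasurable M (ae_of_all _ hM)
  have hind {s : Set (Fin n → ℝ)} (hs : MeasurableSet s) :
      Integrable (s.indicator fun _ => (1 : ℝ)) P := (integrable_const _).indicator hs
  have hset {s : Set (Fin n → ℝ)} (hs : MeasurableSet s) :
      ∫ x in s, g x ∂P = ∫ x, s.indicator (fun _ => (1 : ℝ)) x * g x ∂P := by
    rw [← integral_indicator hs]
    congr 1 with x
    by_cases hx : x ∈ s <;> simp [hx]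
  have hprod {s : Set (Fin n → ℝ)} (hs : MeasurableSet s) :
      Integrable (fun x => s.indicator (fun _ => (1 : ℝ)) x * g x) P := by
    refine (hg_int.indicator hs).congr (ae_of_all _ fun x => ?_)
    by_cases hx : x ∈ s <;> simp [hx]
  have hae : ∀ᵐ x ∂P, ∀ i, 0 ≤ x i := by
    rw [ae_all_iff]
    exact fun i => (measurePreserving_eval (fun _ : Fin n => μ) i).quasiMeasurePreserving.ae hμ
  have hpair : Integrable (fun x => n * ∑ i, ∑ j ∈ Finset.univ.erase i,
      {x : Fin n → ℝ | b * (δ / n) < x i ∧ b * (δ / n) < x j}.indicator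
        (fun _ => (1 : ℝ)) x) P :=
    (integrable_finsetSum _ fun i _ => integrable_finsetSum _ fun j _ => hind (hmE i j)).const_mul _
  have hone : Integrable (fun x => ∑ i, {x : Fin n → ℝ | x i ∈ Ioc (b * (1 - δ)) b}.indicator
      (fun _ => (1 : ℝ)) x) P := integrable_finsetSum _ fun i _ => hind (hmC i)
  simp_rw [hset hmA, fun i => hset (hmB i)]
  rw [← integral_finsetSum _ fun i _ => hprod (hmB i),
    ← integral_sub (hprod hmA) (integrable_finsetSum _ fun i _ => hprod (hmB i)),
    ← Real.norm_eq_abs]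
  refine (norm_integral_le_of_norm_le ((hone.add hpair).const_mul M) ?_).trans ?_
  · filter_upwards [hae] with x hx
    rw [← Finset.sum_mul, ← sub_mul, norm_mul, mul_comm]
    exact mul_le_mul (hM x) (abs_indicator_sum_sub_sum_indicator_le hn hb hδ0 hδ hx)
      (abs_nonneg _) hM0
  · simp only [Pi.add_apply]
    rw [integral_const_mul, integral_add hone hpair, integral_const_mul,
      integral_finsetSum _ fun i _ => hind (hmC i),
      integral_finsetSum _ fun i _ => integrable_finsetSum _ fun j _ => hind (hmE i j)]
    simp_rw [fun i => integral_finsetSum (μ := P) (Finset.univ.erase i)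
      fun j _ => hind (hmE i j)]
    have hI {s : Set (Fin n → ℝ)} (hs : MeasurableSet s) :
        ∫ x, s.indicator (fun _ => (1 : ℝ)) x ∂P = P.real s := integral_indicator_one hs
    simp_rw [fun i => hI (hmC i), fun i j => hI (hmE i j)]
    have hle : b * (1 - δ) ≤ b := by nlinarith
    have h1 (i : Fin n) : P.real {x | x i ∈ Ioc (b * (1 - δ)) b} =
        μ.real (Ioi (b * (1 - δ))) - μ.real (Ioi b) := by
      rw [pi_measureReal_eval_preimage i μ measurableSet_Ioc,
        ← measureReal_sdiff (Ioi_subset_Ioi hle) measurableSet_Ioi, Ioi_sdiff_Ioi]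
    have h2 (i : Fin n) : ∑ j ∈ Finset.univ.erase i,
        P.real {x | b * (δ / n) < x i ∧ b * (δ / n) < x j} ≤
          n * μ.real (Ioi (b * (δ / n))) ^ 2 := by
      calc _ = ∑ j ∈ Finset.univ.erase i, μ.real (Ioi (b * (δ / n))) ^ 2 :=
            Finset.sum_congr rfl fun j hj =>
              pi_measureReal_two_eval_preimage (Finset.ne_of_mem_erase hj).symm μ (Ioi _)
        _ ≤ ∑ _j : Fin n, μ.real (Ioi (b * (δ / n))) ^ 2 :=
            Finset.sum_le_univ_sum_of_nonneg fun _ => by positivity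
        _ = _ := by simp
    simp_rw [h1]
    refine mul_le_mul_of_nonneg_left (add_le_add (le_of_eq ?_) ?_) hM0
    · rw [Finset.sum_const, Finset.card_univ, Fintype.card_fin, nsmul_eq_mul]
    · calc _ ≤ (n : ℝ) * ∑ _i : Fin n, n * μ.real (Ioi (b * (δ / n))) ^ 2 :=
            mul_le_mul_of_nonneg_left (Finset.sum_le_sum fun i _ => h2 i) (by positivity)
        _ = _ := by
            rw [Finset.sum_const, Finset.card_univ, Fintype.card_fin, nsmul_eq_mul]
            ring

theorem tendsto_setIntegral_sum_sub_sum_setIntegral {n : ℕ} (hn : 1 ≤ n) {μ : Measure ℝ}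
    [IsProbabilityMeasure μ] (hμ : ∀ᵐ t ∂μ, 0 ≤ t) {α : ℝ} (hpos : ∀ b, 0 < μ.real (Ioi b))
    (hrv : ∀ x : ℝ, 0 < x →
      Tendsto (fun b => μ.real (Ioi (b * x)) / μ.real (Ioi b)) atTop (nhds (x ^ (-α))))
    {h : (Fin n → ℝ) → ℝ} (hh : Continuous h) {M : ℝ} (hM : ∀ x, |h x| ≤ M) :
    Tendsto (fun b => (∫ x in {x : Fin n → ℝ | b < ∑ i, x i}, h (fun j => x j / b)
        ∂(Measure.pi fun _ => μ)) / μ.real (Ioi b) -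
        ∑ i, (∫ x in {x | b < x i}, h (fun j => x j / b)
          ∂(Measure.pi fun _ => μ)) / μ.real (Ioi b)) atTop (nhds 0) := by
  have hn0 : (0 : ℝ) < n := by exact_mod_cast hn
  have hbound (δ : ℝ) (hδ0 : 0 < δ) (hδ : δ ≤ 1 / 2) :
      Tendsto (fun b => M * (n * (μ.real (Ioi (b * (1 - δ))) / μ.real (Ioi b) - 1) +
        n ^ 3 * (μ.real (Ioi (b * (δ / n))) / μ.real (Ioi b) * μ.real (Ioi (b * (δ / n))))))
        atTop (nhds (M * (n * ((1 - δ) ^ (-α) - 1)))) := by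
    have h0 : Tendsto (fun b => μ.real (Ioi (b * (δ / n)))) atTop (nhds 0) :=
      (tendsto_measureReal_Ioi_atTop μ).comp (tendsto_id.atTop_mul_const (by positivity))
    have := ((((hrv (1 - δ) (by linarith)).sub_const 1).const_mul (n : ℝ)).add
      (((hrv (δ / n) (by positivity)).mul h0).const_mul ((n : ℝ) ^ 3))).const_mul M
    simpa using this
  have hδlim : Tendsto (fun δ : ℝ => M * (n * ((1 - δ) ^ (-α) - 1))) (nhdsWithin 0 (Ioi 0))
      (nhds 0) := by
    have hc : ContinuousAt (fun δ : ℝ => M * (n * ((1 - δ) ^ (-α) - 1))) 0 := by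
      have : ContinuousAt (fun δ : ℝ => (1 - δ) ^ (-α)) 0 :=
        ContinuousAt.rpow_const (by fun_prop) (Or.inl (by simp))
      fun_prop
    have := hc.tendsto.mono_left (nhdsWithin_le_nhds (s := Ioi 0))
    simpa using this
  rw [Metric.tendsto_nhds]
  intro ε hε
  obtain ⟨δ, hδε, hδ0, hδ⟩ := ((hδlim.eventually_lt_const hε).and
    (Ioc_mem_nhdsGT (show (0 : ℝ) < 1 / 2 by norm_num))).exists
  filter_upwards [(hbound δ hδ0 hδ).eventually_lt_const hδε, eventually_gt_atTop 0] with b hlt hb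
  refine lt_of_le_of_lt ?_ hlt
  have hG := hpos b
  rw [dist_zero_right, ← Finset.sum_div, ← sub_div, norm_div, Real.norm_eq_abs,
    Real.norm_eq_abs, abs_of_pos hG, div_le_iff₀ hG]
  refine (abs_setIntegral_sum_sub_sum_setIntegral_le hn hμ hb hδ0 hδ
    (hh.comp (by fun_prop)) fun x => hM _).trans_eq ?_
  field_simp

/-- Weak convergence of the scaled excursion measures m_b to the measure m
concentrated on the coordinate axes: for every bounded continuous h,
∫ h dm_b → Σ_i ∫_1^∞ h(y e_i) α y^{-α-1} dy. -/
theorem stmt_5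
    (n : ℕ) (hn : 1 ≤ n) (α : ℝ) (hα : 0 < α)
    (f : ℝ → ℝ) (hf_nonneg : ∀ x, 0 ≤ f x)
    (hf_int : ∫ x, f x = 1)
    (hf_supp : ∀ x < (0 : ℝ), f x = 0)
    (hf_rv : ∀ x : ℝ, 0 < x →
      Tendsto (fun u => f (u * x) / f u) atTop (nhds (x ^ (-α - 1))))
    (Fbar : ℝ → ℝ) (hFbar : ∀ b, Fbar b = ∫ t in Ioi b, f t)
    (hFbar_pos : ∀ b, 0 < Fbar b)
    (h : (Fin n → ℝ) → ℝ) (hh_cont : Continuous h)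
    (hh_bdd : ∃ M : ℝ, ∀ x, |h x| ≤ M) :
    Tendsto
      (fun b => (∫ x in {x : Fin n → ℝ | b < ∑ i, x i},
          h (fun i => x i / b) * ∏ i : Fin n, f (x i)) / Fbar b)
      atTop
      (nhds (∑ i : Fin n, ∫ y in Ioi (1 : ℝ),
        h (fun j => if j = i then y else 0) * (α * y ^ (-α - 1)))) := by
  obtain ⟨M, hM⟩ := hh_bdd
  have hf : Integrable f := by
    by_contra hf
    rw [integral_undef hf] at hf_int
    exact zero_ne_one hf_int
  set μ : Measure ℝ := volume.withDensity fun t => ENNReal.ofReal (f t) with hμ_def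
  have hprob : IsProbabilityMeasure μ := ⟨by
    rw [hμ_def, withDensity_apply _ MeasurableSet.univ, Measure.restrict_univ,
      ← ofReal_integral_eq_lintegral_ofReal hf (ae_of_all _ hf_nonneg), hf_int,
      ENNReal.ofReal_one]⟩
  have hG (b : ℝ) : μ.real (Ioi b) = Fbar b := by
    rw [hFbar, hμ_def, measureReal_def, withDensity_apply _ measurableSet_Ioi,
      ← ofReal_integral_eq_lintegral_ofReal hf.integrableOn (ae_of_all _ hf_nonneg),
      ENNReal.toReal_ofReal (integral_nonneg hf_nonneg)]
  have hμ_nonneg : ∀ᵐ t ∂μ, 0 ≤ t := by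
    have h0 : μ (Iio 0) = 0 := by
      rw [hμ_def, withDensity_apply _ measurableSet_Iio,
        setLIntegral_congr_fun measurableSet_Iio (g := fun _ => 0)
          (fun t ht => by simp [hf_supp t ht]), lintegral_zero]
    rw [ae_iff]
    simp only [not_le]
    exact h0
  have hpos (b : ℝ) : 0 < μ.real (Ioi b) := hG b ▸ hFbar_pos b
  have hrv (x : ℝ) (hx : 0 < x) :
      Tendsto (fun b => μ.real (Ioi (b * x)) / μ.real (Ioi b)) atTop (nhds (x ^ (-α))) := by
    simp_rw [hG, hFbar]
    exact tendsto_tail_ratio_of_density_ratio hf_nonneg hf hf_rv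
      (fun b => hFbar b ▸ hFbar_pos b) hx
  have hmeas : AEMeasurable (fun x : Fin n → ℝ => ENNReal.ofReal (∏ i, f (x i))) := by
    have : Integrable (fun x : Fin n → ℝ => ∏ i, f (x i)) := by
      rw [volume_pi]
      exact Integrable.fintype_prod fun _ => hf
    exact this.aestronglyMeasurable.aemeasurable.ennreal_ofReal
  have hmA (b : ℝ) : MeasurableSet {x : Fin n → ℝ | b < ∑ i, x i} :=
    measurableSet_lt measurable_const (by fun_prop)
  have hconv (b : ℝ) : ∫ x in {x : Fin n → ℝ | b < ∑ i, x i},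
      h (fun i => x i / b) * ∏ i : Fin n, f (x i) =
      ∫ x in {x : Fin n → ℝ | b < ∑ i, x i}, h (fun i => x i / b) ∂(Measure.pi fun _ => μ) := by
    rw [hμ_def, ← withDensity_prod_eq_pi hf_nonneg hf,
      setIntegral_withDensity_eq_setIntegral_toReal_smul₀ hmeas.restrict
        (ae_of_all _ fun _ => ENNReal.ofReal_lt_top) _ (hmA b)]
    congr 1 with x
    rw [ENNReal.toReal_ofReal (Finset.prod_nonneg fun i _ => hf_nonneg _), smul_eq_mul, mul_comm]
  simp_rw [hconv, ← hG]
  have hsingle := tendsto_finsetSum Finset.univ fun i _ =>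
    tendsto_setIntegral_single_exceedance hα hpos hrv hh_cont hM i
  simpa using
    (tendsto_setIntegral_sum_sub_sum_setIntegral hn hμ_nonneg hpos hrv hh_cont hM).add hsingle
end

section
/- Fix n ≥ 1, α > 0, a ∈ (0,1). Let m be the measure on ℝ^n given by m(A) = Σ_{i=1}^n ∫_1^∞ 1{ y·e_i ∈ A } α y^{−α−1} dy, where e_i is the i-th standard basis vector. For 1 ≤ i ≤ n define A_i = { y ∈ ℝ^n : y_j ≤ a(1−s_{j−1}) for 1 ≤ j ≤ i−1, y_i > 1−s_{i−1}, and s_k > 1 for k = i+1,…,n }, where s_k = y_1+⋯+y_k. Then the sets A_1,…,A_n have pairwise disjoint closures, m(∂A_i) = 0 for each i, and m( { y : s_n > 1 } \ ∪_{i=1}^n A_i ) = 0. -/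
open MeasureTheory Filter Set Real

/-- Properties of the sets A_i with respect to the limit measure m concentrated on
the coordinate axes: the A_i have pairwise disjoint closures, m(∂A_i) = 0, and
m({s_n > 1} \ ∪ A_i) = 0. -/
theorem stmt_7
    (n : ℕ) (hn : 1 ≤ n) (α : ℝ) (hα : 0 < α) (a : ℝ) (ha : a ∈ Ioo (0 : ℝ) 1)
    (S : (Fin n → ℝ) → ℕ → ℝ)
    (hS : ∀ y k, S y k = ∑ j ∈ Finset.univ.filter (fun j : Fin n => (j : ℕ) < k), y j)
    -- the measure m(A) = Σ_i ∫_1^∞ 1{y e_i ∈ A} α y^{-α-1} dy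
    (m : Set (Fin n → ℝ) → ℝ)
    (hm : ∀ A : Set (Fin n → ℝ), m A = ∑ i : Fin n, ∫ y in Ioi (1 : ℝ),
      A.indicator (fun _ => α * y ^ (-α - 1)) (fun j => if j = i then y else 0))
    -- the sets A_i
    (A : Fin n → Set (Fin n → ℝ))
    (hA : ∀ i : Fin n, A i = {y : Fin n → ℝ |
      (∀ j : Fin n, j < i → y j ≤ a * (1 - S y (j : ℕ))) ∧
      1 - S y (i : ℕ) < y i ∧
      (∀ k : ℕ, (i : ℕ) + 1 < k → k ≤ n → 1 < S y k)}) :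
    (∀ i j : Fin n, i ≠ j → closure (A i) ∩ closure (A j) = ∅) ∧
    (∀ i : Fin n, m (frontier (A i)) = 0) ∧
    m ({y : Fin n → ℝ | 1 < S y n} \ ⋃ i : Fin n, A i) = 0 := by
  obtain ⟨ha0, ha1⟩ := ha
  have hcont : ∀ k, Continuous fun y => S y k := fun k => by
    simp only [hS]
    fun_prop
  have hzero : ∀ y, S y 0 = 0 := fun y => by simp [hS]
  have hsucc : ∀ y (i : Fin n), S y ((i : ℕ) + 1) = S y i + y i := fun y i => by
    have : (Finset.univ.filter fun j : Fin n => (j : ℕ) < (i : ℕ) + 1) =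
        insert i (Finset.univ.filter fun j : Fin n => (j : ℕ) < i) := by
      ext j
      simp only [Finset.mem_filter, Finset.mem_univ, true_and, Finset.mem_insert, Fin.ext_iff]
      omega
    rw [hS, hS, this, Finset.sum_insert (by simp), add_comm]
  have haxis : ∀ (i : Fin n) (t : ℝ) (k : ℕ),
      S (fun j => if j = i then t else 0) k = if (i : ℕ) < k then t else 0 := fun i t k => by
    simp [hS, Finset.sum_ite_eq']
  have hclosure : ∀ (i : Fin n) (y : Fin n → ℝ), y ∈ closure (A i) →
      (∀ j : Fin n, j < i → y j ≤ a * (1 - S y (j : ℕ))) ∧ 1 ≤ S y ((i : ℕ) + 1) := by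
    intro i
    have hclosed : IsClosed {y : Fin n → ℝ |
        (∀ j : Fin n, j < i → y j ≤ a * (1 - S y (j : ℕ))) ∧ 1 ≤ S y ((i : ℕ) + 1)} := by
      simp only [ofPred_and, ofPred_forall]
      refine IsClosed.inter (isClosed_iInter fun j => isClosed_iInter fun _ => ?_) ?_
      · exact isClosed_le (continuous_apply j)
          (continuous_const.mul (continuous_const.sub (hcont j)))
      · exact isClosed_le continuous_const (hcont _)
    refine closure_minimal (fun y hy => ?_) hclosed
    rw [hA] at hy
    exact ⟨hy.1, by rw [hsucc]; linarith [hy.2.1]⟩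
  have hdisj : ∀ i j : Fin n, i < j → ∀ y, y ∈ closure (A i) → y ∉ closure (A j) := by
    intro i j hij y hyi hyj
    have hpos : ∀ k : ℕ, k ≤ j → S y k < 1 := by
      intro k
      induction k with
      | zero => intro _; rw [hzero]; exact one_pos
      | succ k ih =>
        intro hk
        have hle := (hclosure j y hyj).1 ⟨k, by omega⟩ (by rw [Fin.lt_def]; exact hk)
        have heq := hsucc y ⟨k, by omega⟩
        simp only at hle heq
        nlinarith [ih (by omega)]
    linarith [hpos (i + 1) hij, (hclosure i y hyi).2]
  have hinterior : ∀ (i : Fin n) (t : ℝ), 1 < t →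
      (fun j => if j = i then t else 0) ∈ interior (A i) := by
    intro i t ht
    have hopen : IsOpen {y : Fin n → ℝ |
        (∀ j : Fin n, j < i → y j < a * (1 - S y (j : ℕ))) ∧ 1 - S y (i : ℕ) < y i ∧
        (∀ k : Fin (n + 1), (i : ℕ) + 1 < k → 1 < S y k)} := by
      simp only [ofPred_and, ofPred_forall]
      refine IsOpen.inter (isOpen_iInter_of_finite fun j => isOpen_iInter_of_finite fun _ => ?_)
        (IsOpen.inter ?_ (isOpen_iInter_of_finite fun k => isOpen_iInter_of_finite fun _ => ?_))
      · exact isOpen_lt (continuous_apply j)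
          (continuous_const.mul (continuous_const.sub (hcont j)))
      · exact isOpen_lt (continuous_const.sub (hcont i)) (continuous_apply i)
      · exact isOpen_lt continuous_const (hcont _)
    refine interior_maximal (fun y hy => ?_) hopen ⟨fun j hj => ?_, ?_, fun k hk => ?_⟩
    · rw [hA]
      exact ⟨fun j hj => (hy.1 j hj).le, hy.2.1,
        fun k hk hkn => hy.2.2 ⟨k, by omega⟩ hk⟩
    · rw [haxis, if_neg (by rw [Fin.lt_def] at hj; omega)]
      simpa [hj.ne] using ha0
    · rw [haxis]
      simpa using ht
    · rw [haxis, if_pos (by omega)]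
      exact ht
  have hnull : ∀ B : Set (Fin n → ℝ),
      (∀ (i : Fin n) (t : ℝ), 1 < t → (fun j => if j = i then t else 0) ∉ B) → m B = 0 := by
    intro B hB
    rw [hm]
    refine Finset.sum_eq_zero fun i _ => setIntegral_eq_zero_of_forall_eq_zero fun t ht => ?_
    exact indicator_of_notMem (hB i t ht) _
  refine ⟨fun i j hij => ?_, fun i => hnull _ fun k t ht hk => ?_, hnull _ fun k t ht hk => ?_⟩
  · refine eq_empty_of_forall_notMem fun y hy => ?_
    rcases hij.lt_or_gt with h | h
    · exact hdisj i j h y hy.1 hy.2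
    · exact hdisj j i h y hy.2 hy.1
  · have hint := hinterior k t ht
    rcases lt_trichotomy i k with h | rfl | h
    · exact hdisj i k h _ hk.1 (subset_closure (interior_subset hint))
    · exact hk.2 hint
    · exact hdisj k i h _ (subset_closure (interior_subset hint)) hk.1
  · exact hk.2 (mem_iUnion.2 ⟨k, interior_subset (hinterior k t ht)⟩)
end

section
/- Fix an integer n ≥ 2, α > 0 and a ∈ (0,1), and set c = a^{−α/2} ≥ 1. Over all (p_1,…,p_{n−1}) ∈ (0,1)^{n−1} with q_i = 1−p_i, the quantity B(p) = Σ_{i=1}^{n−1} a^{−α} (1/q_i) ∏_{j=1}^{i−1} (1/p_j) + ∏_{j=1}^{n−1} (1/p_j) is minimized at p_i = ((n−i−1)c + 1)/((n−i)c + 1) for 1 ≤ i ≤ n−1, and the minimum value is ((n−1)c + 1)² = ((n−1)a^{−α/2} + 1)². -/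
open Set Real

/-- The two-term Cauchy–Schwarz (Titu) inequality with weights `p` and `1 - p`. -/
lemma add_sq_le_sq_mul_inv_add {c s p : ℝ} (hp : p ∈ Ioo (0 : ℝ) 1) :
    (c + s) ^ 2 ≤ c ^ 2 * (1 - p)⁻¹ + s ^ 2 * p⁻¹ := by
  have hp0 : 0 < p := hp.1
  have hq0 : 0 < 1 - p := sub_pos.2 hp.2
  rw [← sub_nonneg]
  have h : c ^ 2 * (1 - p)⁻¹ + s ^ 2 * p⁻¹ - (c + s) ^ 2
      = (c * p - s * (1 - p)) ^ 2 / (p * (1 - p)) := by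
    field_simp
    ring
  rw [h]
  positivity

/-- The equality case of `add_sq_le_sq_mul_inv_add`. -/
lemma add_sq_eq_sq_mul_inv_add {c s : ℝ} (hc : 0 < c) (hs : 0 < s) :
    c ^ 2 * (1 - s / (c + s))⁻¹ + s ^ 2 * (s / (c + s))⁻¹ = (c + s) ^ 2 := by
  have h : 1 - s / (c + s) = c / (c + s) := by
    field_simp
    ring
  rw [h]
  field_simp

/-- Adding one stage to the sum turns the continuation value `w` into
`d * (1 - p m)⁻¹ + w * (p m)⁻¹`. -/
lemma sum_prod_inv_succ (d w : ℝ) (p : ℕ → ℝ) {m : ℕ} (hm : 1 ≤ m) :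
    (∑ i ∈ Finset.Ico 1 (m + 1), d * (1 - p i)⁻¹ * ∏ j ∈ Finset.Ico 1 i, (p j)⁻¹) +
        w * ∏ j ∈ Finset.Ico 1 (m + 1), (p j)⁻¹ =
      (∑ i ∈ Finset.Ico 1 m, d * (1 - p i)⁻¹ * ∏ j ∈ Finset.Ico 1 i, (p j)⁻¹) +
        (d * (1 - p m)⁻¹ + w * (p m)⁻¹) * ∏ j ∈ Finset.Ico 1 m, (p j)⁻¹ := by
  rw [Finset.sum_Ico_succ_top hm, Finset.prod_Ico_succ_top hm]
  ring

/-- With c = a^{-α/2} ≥ 1, the quantity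
B(p) = Σ_{i=1}^{n-1} a^{-α} (1/q_i) Π_{j=1}^{i-1} (1/p_j) + Π_{j=1}^{n-1} (1/p_j)
is minimized over (p_1,…,p_{n-1}) ∈ (0,1)^{n-1} at
p_i = ((n-i-1)c+1)/((n-i)c+1), with minimum value ((n-1)c+1)². -/
theorem stmt_10
    (n : ℕ) (hn : 2 ≤ n) (α : ℝ) (hα : 0 < α) (a : ℝ) (ha : a ∈ Ioo (0 : ℝ) 1)
    (c : ℝ) (hc : c = a ^ (-(α / 2)))
    (B : (ℕ → ℝ) → ℝ)
    (hB : ∀ p : ℕ → ℝ, B p =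
      (∑ i ∈ Finset.Ico 1 n, a ^ (-α) * (1 - p i)⁻¹ * ∏ j ∈ Finset.Ico 1 i, (p j)⁻¹) +
      ∏ j ∈ Finset.Ico 1 n, (p j)⁻¹)
    (pstar : ℕ → ℝ)
    (hpstar : ∀ i, pstar i = (((n : ℝ) - i - 1) * c + 1) / (((n : ℝ) - i) * c + 1)) :
    1 ≤ c ∧
    (∀ i, 1 ≤ i → i < n → pstar i ∈ Ioo (0 : ℝ) 1) ∧
    B pstar = (((n : ℝ) - 1) * c + 1) ^ 2 ∧
    (∀ p : ℕ → ℝ, (∀ i, 1 ≤ i → i < n → p i ∈ Ioo (0 : ℝ) 1) →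
      (((n : ℝ) - 1) * c + 1) ^ 2 ≤ B p) := by
  obtain ⟨ha0, ha1⟩ := ha
  have hc1 : 1 ≤ c := by
    rw [hc]
    exact Real.one_le_rpow_of_pos_of_le_one_of_nonpos ha0 ha1.le (by linarith)
  have hc0 : 0 < c := by linarith
  have hd : a ^ (-α) = c ^ 2 := by
    rw [hc, ← Real.rpow_mul_natCast ha0.le]
    congr 1
    push_cast
    ring
  have hs : ∀ i, i < n → 0 < ((n : ℝ) - i - 1) * c + 1 := by
    intro i hi
    have h : (i : ℝ) + 1 ≤ n := by exact_mod_cast hi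
    have : 0 ≤ ((n : ℝ) - i - 1) * c := mul_nonneg (by linarith) hc0.le
    linarith
  have hpstar' : ∀ i, pstar i =
      (((n : ℝ) - i - 1) * c + 1) / (c + (((n : ℝ) - i - 1) * c + 1)) := by
    intro i
    rw [hpstar]
    congr 1
    ring
  refine ⟨hc1, ?_, ?_, ?_⟩
  · intro i _ hi
    have h := hs i hi
    rw [hpstar']
    exact ⟨by positivity, (div_lt_one (by positivity)).2 (by linarith)⟩
  · have key : ∀ m, 1 ≤ m → m ≤ n →
        (∑ i ∈ Finset.Ico 1 m,
            c ^ 2 * (1 - pstar i)⁻¹ * ∏ j ∈ Finset.Ico 1 i, (pstar j)⁻¹) +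
          (((n : ℝ) - m) * c + 1) ^ 2 * ∏ j ∈ Finset.Ico 1 m, (pstar j)⁻¹ =
        (((n : ℝ) - 1) * c + 1) ^ 2 := by
      intro m hm
      induction m, hm using Nat.le_induction with
      | base => simp
      | succ m hm ih =>
        intro hmn
        rw [sum_prod_inv_succ _ _ _ hm, ← ih (by omega), hpstar' m]
        push_cast
        rw [← sub_sub, add_sq_eq_sq_mul_inv_add hc0 (hs m hmn)]
        ring
    have h := key n (by omega) le_rfl
    rw [hB, hd, ← h]
    simp
  · intro p hp
    have key : ∀ m, 1 ≤ m → m ≤ n →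
        (((n : ℝ) - 1) * c + 1) ^ 2 ≤
        (∑ i ∈ Finset.Ico 1 m, c ^ 2 * (1 - p i)⁻¹ * ∏ j ∈ Finset.Ico 1 i, (p j)⁻¹) +
          (((n : ℝ) - m) * c + 1) ^ 2 * ∏ j ∈ Finset.Ico 1 m, (p j)⁻¹ := by
      intro m hm
      induction m, hm using Nat.le_induction with
      | base => simp
      | succ m hm ih =>
        intro hmn
        refine (ih (by omega)).trans ?_
        rw [sum_prod_inv_succ _ _ _ hm]
        have hP : 0 ≤ ∏ j ∈ Finset.Ico 1 m, (p j)⁻¹ := by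
          refine Finset.prod_nonneg fun j hj => inv_nonneg.2 ?_
          obtain ⟨hj1, hjm⟩ := Finset.mem_Ico.1 hj
          exact (hp j hj1 (by omega)).1.le
        gcongr
        push_cast
        rw [← sub_sub]
        calc (((n : ℝ) - m) * c + 1) ^ 2
            = (c + (((n : ℝ) - m - 1) * c + 1)) ^ 2 := by ring
          _ ≤ _ := add_sq_le_sq_mul_inv_add (hp m hm hmn)
    have h := key n (by omega) le_rfl
    rw [hB, hd]
    simpa using h
end

section
/- Fix an integer n ≥ 1. Over all (p_1,…,p_{n−1}) ∈ (0,1)^{n−1} with q_i = 1−p_i and the convention q_n = 1, the quantity (1/n²) Σ_{i=1}^n (1/q_i) ∏_{j=1}^{i−1} (1/p_j) is minimized at p_i = 1 − 1/(n−i+1) for 1 ≤ i ≤ n−1, and the minimum value is 1. In particular, (1/n²) Σ_{i=1}^n (1/q_i) ∏_{j=1}^{i−1} (1/p_j) ≥ 1 for all (p_1,…,p_{n−1}) ∈ (0,1)^{n−1}. -/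
open Set Real

theorem add_one_sq_le_inv_add_sq_mul_inv {p : ℝ} (hp : p ∈ Ioo (0 : ℝ) 1) (m : ℝ) :
    (m + 1) ^ 2 ≤ (1 - p)⁻¹ + p⁻¹ * m ^ 2 := by
  have h0 : 0 < p := hp.1
  have h1 : 0 < 1 - p := sub_pos.2 hp.2
  have key : (1 - p)⁻¹ + p⁻¹ * m ^ 2 - (m + 1) ^ 2 = (p - m * (1 - p)) ^ 2 / ((1 - p) * p) := by
    field_simp
    ring
  have : 0 ≤ (p - m * (1 - p)) ^ 2 / ((1 - p) * p) := by positivity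
  linarith

theorem sq_le_sum_inv_mul_prod_inv_add (a : ℝ) (p : ℕ → ℝ) (k : ℕ)
    (hp : ∀ i, 1 ≤ i → i ≤ k → p i ∈ Ioo (0 : ℝ) 1) :
    a ^ 2 ≤ ∑ i ∈ Finset.Icc 1 k, (1 - p i)⁻¹ * ∏ j ∈ Finset.Ico 1 i, (p j)⁻¹ +
      (∏ j ∈ Finset.Ico 1 (k + 1), (p j)⁻¹) * (a - k) ^ 2 := by
  induction k with
  | zero => simp
  | succ k ih =>
    have hprod : 0 ≤ ∏ j ∈ Finset.Ico 1 (k + 1), (p j)⁻¹ := by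
      refine Finset.prod_nonneg fun j hj => inv_nonneg.2 ?_
      rw [Finset.mem_Ico] at hj
      exact (hp j hj.1 (by omega)).1.le
    have hstep := mul_le_mul_of_nonneg_left
      (add_one_sq_le_inv_add_sq_mul_inv (hp (k + 1) (by omega) le_rfl) (a - k - 1)) hprod
    rw [Finset.sum_Icc_succ_top (by omega), Finset.prod_Ico_succ_top (show 1 ≤ k + 1 by omega)]
    have := ih fun i hi hik => hp i hi (by omega)
    push_cast
    ring_nf at this hstep ⊢
    linarith

theorem prod_inv_one_sub_one_div (a : ℝ) (k : ℕ) (hk : (k : ℝ) < a) :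
    ∏ j ∈ Finset.Ico 1 (k + 1), (1 - 1 / (a - j + 1))⁻¹ = a / (a - k) := by
  induction k with
  | zero =>
    have : a ≠ 0 := by
      rintro rfl
      simp at hk
    simp [this]
  | succ k ih =>
    push_cast at hk
    rw [Finset.prod_Ico_succ_top (by omega), ih (by linarith)]
    have h1 : a - k ≠ 0 := by linarith
    have h2 : a - (k + 1) ≠ 0 := by linarith
    have h3 : 1 - 1 / (a - ((k + 1 : ℕ) : ℝ) + 1) = (a - (k + 1)) / (a - k) := by
      push_cast
      rw [show a - ((k : ℝ) + 1) + 1 = a - k by ring]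
      field_simp
      ring
    rw [h3, inv_div]
    push_cast
    field_simp

/-- The mixing-probability factor (1/n²) Σ_{i=1}^n (1/q_i) Π_{j=1}^{i-1} (1/p_j)
(with q_i = 1 - p_i for i < n and q_n = 1) is minimized over
(p_1,…,p_{n-1}) ∈ (0,1)^{n-1} at p_i = 1 - 1/(n-i+1), with minimum value 1. -/
theorem stmt_16
    (n : ℕ) (hn : 1 ≤ n)
    (T : (ℕ → ℝ) → ℝ)
    (hT : ∀ p : ℕ → ℝ, T p = (1 / (n : ℝ) ^ 2) *
      ∑ i ∈ Finset.Icc 1 n,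
        (if i = n then (1 : ℝ) else 1 - p i)⁻¹ * ∏ j ∈ Finset.Ico 1 i, (p j)⁻¹)
    (pstar : ℕ → ℝ)
    (hpstar : ∀ i, pstar i = 1 - 1 / ((n : ℝ) - i + 1)) :
    (∀ i, 1 ≤ i → i < n → pstar i ∈ Ioo (0 : ℝ) 1) ∧
    T pstar = 1 ∧
    (∀ p : ℕ → ℝ, (∀ i, 1 ≤ i → i < n → p i ∈ Ioo (0 : ℝ) 1) → 1 ≤ T p) := by
  have hn0 : (0 : ℝ) < n := by exact_mod_cast hn
  refine ⟨fun i _ hin => ?_, ?_, fun p hp => ?_⟩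
  · have hi : (i : ℝ) < n := by exact_mod_cast hin
    have hpos : (0 : ℝ) < n - i + 1 := by linarith
    rw [hpstar]
    refine ⟨sub_pos.2 ((div_lt_one hpos).2 (by linarith)), ?_⟩
    have : 0 < 1 / ((n : ℝ) - i + 1) := by positivity
    linarith
  · have hterm : ∀ i ∈ Finset.Icc 1 n, (if i = n then (1 : ℝ) else 1 - pstar i)⁻¹ *
        ∏ j ∈ Finset.Ico 1 i, (pstar j)⁻¹ = n := by
      intro i hi
      obtain ⟨h1, h2⟩ := Finset.mem_Icc.1 hi
      obtain ⟨k, rfl⟩ : ∃ k, i = k + 1 := ⟨i - 1, by omega⟩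
      have hk : (k : ℝ) < n := by exact_mod_cast h2
      have hq : (if k + 1 = n then (1 : ℝ) else 1 - pstar (k + 1))⁻¹ = n - k := by
        split_ifs with h
        · rw [← h]
          simp
        · rw [hpstar]
          push_cast
          rw [sub_sub_cancel, one_div, inv_inv]
          ring
      simp_rw [hq, hpstar]
      rw [prod_inv_one_sub_one_div _ _ hk, mul_div_cancel₀ _ (sub_pos.2 hk).ne']
    rw [hT, Finset.sum_congr rfl hterm]
    simp only [Finset.sum_const, Nat.card_Icc, Nat.add_sub_cancel, nsmul_eq_mul]
    field_simp
  · rw [hT, one_div_mul_eq_div, one_le_div (by positivity)]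
    obtain ⟨m, rfl⟩ : ∃ m, n = m + 1 := ⟨n - 1, by omega⟩
    refine (sq_le_sum_inv_mul_prod_inv_add _ p m fun i hi him => hp i hi (by omega)).trans_eq ?_
    rw [Finset.sum_Icc_succ_top (by omega)]
    congr 1
    · refine Finset.sum_congr rfl fun i hi => ?_
      have := (Finset.mem_Icc.1 hi).2
      rw [if_neg (by omega)]
    · simp
end
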